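/- Under Assumptions A3 and A4, for any x ≥ 0 the series B⁺ := Σ_{i=0}^∞ η_{i+1} e^{−S_i} converges, i.e., lim_{n→∞} b_n = B⁺ < ∞, P_x⁺-almost surely; and for any x ≤ 0 the series B⁻ := Σ_{i=1}^∞ η_i e^{S_i} converges P_x⁻-almost surely, where b_n = Σ_{i=0}^{n−1} η_{i+1} e^{−S_i}. -/

import Mathlib

open MeasureTheory ProbabilityTheory Filter Set Topology

noncomputable section

namespace BPREpaper

variable {Ω : Type*} [MeasurableSpace Ω]

/-- The random walk `S n = X 1 + ... + X n` (increments indexed from `1`, `S 0 = 0`). -/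
def walk (X : ℕ → Ω → ℝ) (n : ℕ) (ω : Ω) : ℝ := ∑ i ∈ Finset.Icc 1 n, X i ω

/-- `Mwalk X n = max (S 1, ..., S n)` for `n ≥ 1` (junk value `0` for `n = 0`). -/
def Mwalk (X : ℕ → Ω → ℝ) : ℕ → Ω → ℝ
  | 0, _ => 0
  | n + 1, ω =>
      (Finset.Icc 1 (n + 1)).sup' (Finset.nonempty_Icc.mpr (by omega)) fun i => walk X i ω

/-- `Lwalk X n = min (S 1, ..., S n)` for `n ≥ 1` (junk value `0` for `n = 0`). -/
def Lwalk (X : ℕ → Ω → ℝ) : ℕ → Ω → ℝ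
  | 0, _ => 0
  | n + 1, ω =>
      (Finset.Icc 1 (n + 1)).inf' (Finset.nonempty_Icc.mpr (by omega)) fun i => walk X i ω

/-- minimum of `S 0, S 1, ..., S n`. -/
def minWalk (X : ℕ → Ω → ℝ) (n : ℕ) (ω : Ω) : ℝ :=
  (Finset.range (n + 1)).inf' (by simp) fun i => walk X i ω

/-- `τ(n)`: the first moment at which the minimum of `S 0, ..., S n` is attained. -/
def tauWalk (X : ℕ → Ω → ℝ) (n : ℕ) (ω : Ω) : ℕ :=
  sInf {i : ℕ | walk X i ω = minWalk X n ω}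

/-- The renewal function `u(x) = 1 + ∑_{k ≥ 1} P(-S_k ≤ x, M_k < 0)` for `x ≥ 0`,
`u(x) = 0` for `x < 0`. -/
def uFun (μ : Measure Ω) (X : ℕ → Ω → ℝ) (x : ℝ) : ℝ :=
  if 0 ≤ x then
    1 + ∑' k : ℕ, (μ {ω | -walk X (k + 1) ω ≤ x ∧ Mwalk X (k + 1) ω < 0}).toReal
  else 0

/-- The renewal function `v(x) = 1 + ∑_{k ≥ 1} P(-S_k > x, L_k ≥ 0)` for `x ≤ 0`,
`v(x) = 0` for `x > 0`. -/
def vFun (μ : Measure Ω) (X : ℕ → Ω → ℝ) (x : ℝ) : ℝ :=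
  if x ≤ 0 then
    1 + ∑' k : ℕ, (μ {ω | x < -walk X (k + 1) ω ∧ 0 ≤ Lwalk X (k + 1) ω}).toReal
  else 0

/-- The event `{∀ 1 ≤ i ≤ n, x + S_i ≥ 0} = {L_n ≥ 0}` for the walk started at `x`. -/
def posSet (X : ℕ → Ω → ℝ) (x : ℝ) (n : ℕ) : Set Ω :=
  {ω | ∀ i ∈ Finset.Icc 1 n, 0 ≤ x + walk X i ω}

/-- The event `{∀ 1 ≤ i ≤ n, x + S_i < 0} = {M_n < 0}` for the walk started at `x`. -/
def negSet (X : ℕ → Ω → ℝ) (x : ℝ) (n : ℕ) : Set Ω :=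
  {ω | ∀ i ∈ Finset.Icc 1 n, x + walk X i ω < 0}

/-- A distribution on `ℝ` is non-lattice: it is not concentrated on any arithmetic
progression `a + hℤ`. -/
def NonLattice (ν : Measure ℝ) : Prop :=
  ¬ ∃ a h : ℝ, ν {x | ∃ k : ℤ, x = a + k * h} = 1

/-- `ν` is an `α`-stable law on `ℝ`. -/
def IsStableLaw (α : ℝ) (ν : Measure ℝ) : Prop :=
  ∀ a b : ℝ, 0 < a → 0 < b → ∃ c d : ℝ, 0 < c ∧ a ^ α + b ^ α = c ^ α ∧
    ((ν.map (fun x => a * x)).prod (ν.map (fun x => b * x))).map (fun p : ℝ × ℝ => p.1 + p.2)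
      = ν.map (fun x => c * x + d)

/-- Weak convergence of a sequence of laws on `ℝ`, tested against bounded continuous
functions. -/
def WeakTendsto (μs : ℕ → Measure ℝ) (ν : Measure ℝ) : Prop :=
  ∀ g : BoundedContinuousFunction ℝ ℝ,
    Tendsto (fun n => ∫ x, g x ∂(μs n)) atTop (𝓝 (∫ x, g x ∂ν))

/-- Assumption A4: there are norming constants `c n → ∞` such that `S n / c n` converges in
distribution to an `α`-stable law concentrated neither on `[0,∞)` nor on `(-∞,0]`; the
increment distribution is non-lattice. -/
def AssumptionA4 (μ : Measure Ω) (X : ℕ → Ω → ℝ) (c : ℕ → ℝ) : Prop :=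
  Tendsto c atTop atTop ∧ NonLattice (μ.map (X 1)) ∧
    ∃ (α : ℝ) (ν : Measure ℝ), IsProbabilityMeasure ν ∧ IsStableLaw α ν ∧
      0 < ν (Set.Iio 0) ∧ 0 < ν (Set.Ioi 0) ∧
      WeakTendsto (fun n => μ.map fun ω => walk X n ω / c n) ν

/-- A family of random elements indexed by `ι` which is i.i.d. (the common distribution
being that of the element with index `i0`). -/
def IIDfam {ι : Type*} {E : Type*} [MeasurableSpace E] (μ : Measure Ω) (Q : ι → Ω → E)
    (i0 : ι) : Prop :=
  (∀ i, Measurable (Q i)) ∧ iIndepFun Q μ ∧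
    ∀ i, IdentDistrib (Q i) (Q i0) μ μ

/-- An i.i.d. sequence indexed by `ℕ` (indices from `1` are the relevant ones). -/
def IIDseq {E : Type*} [MeasurableSpace E] (μ : Measure Ω) (Q : ℕ → Ω → E) : Prop :=
  IIDfam μ Q 1

/-- `P` is the h-transform measure `P_x⁺`: for every `n` and every bounded
`F n`-measurable `g`, `E_P[g] = u(x)⁻¹ E_x[g · u(S_n); L_n ≥ 0]`. -/
def IsPplus (μ : Measure Ω) (X : ℕ → Ω → ℝ) (F : ℕ → MeasurableSpace Ω) (x : ℝ)
    (P : Measure Ω) : Prop :=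
  IsProbabilityMeasure P ∧
    ∀ (n : ℕ) (g : Ω → ℝ), Measurable[F n] g → (∃ C, ∀ ω, |g ω| ≤ C) →
      ∫ ω, g ω ∂P =
        (uFun μ X x)⁻¹ * ∫ ω in posSet X x n, g ω * uFun μ X (x + walk X n ω) ∂μ

/-- `P` is the h-transform measure `P_x⁻`: for every `n` and every bounded
`F n`-measurable `g`, `E_P[g] = v(x)⁻¹ E_x[g · v(S_n); M_n < 0]`. -/
def IsPminus (μ : Measure Ω) (X : ℕ → Ω → ℝ) (F : ℕ → MeasurableSpace Ω) (x : ℝ)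
    (P : Measure Ω) : Prop :=
  IsProbabilityMeasure P ∧
    ∀ (n : ℕ) (g : Ω → ℝ), Measurable[F n] g → (∃ C, ∀ ω, |g ω| ≤ C) →
      ∫ ω, g ω ∂P =
        (vFun μ X x)⁻¹ * ∫ ω in negSet X x n, g ω * vFun μ X (x + walk X n ω) ∂μ

/-- The filtration generated by the environment `Q 1, ..., Q n`. -/
def envFiltration {E : Type*} [MeasurableSpace E] (Q : ℕ → Ω → E) (n : ℕ) :
    MeasurableSpace Ω :=
  ⨆ i ∈ Finset.Icc 1 n, MeasurableSpace.comap (Q i) inferInstance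

/-- The σ-algebra generated by the whole environment `Q 1, Q 2, ...`. -/
def envSigma {E : Type*} [MeasurableSpace E] (Q : ℕ → Ω → E) : MeasurableSpace Ω :=
  ⨆ i, MeasurableSpace.comap (Q (i + 1)) inferInstance




/-- Probability generating function of the (random) offspring law `Q n`. -/
def pgf (Q : ℕ → Ω → Measure ℕ) (n : ℕ) (ω : Ω) (s : ℝ) : ℝ :=
  ∑' i : ℕ, (Q n ω {i}).toReal * s ^ i

/-- Mean `m(Q_n)` of the offspring law `Q n`. -/
def meanQ (Q : ℕ → Ω → Measure ℕ) (n : ℕ) (ω : Ω) : ℝ :=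
  ∑' i : ℕ, (i : ℝ) * (Q n ω {i}).toReal

/-- `X_n = log f_n'(1)`, the increments of the associated random walk. -/
def Xenv (Q : ℕ → Ω → Measure ℕ) (n : ℕ) (ω : Ω) : ℝ := Real.log (meanQ Q n ω)

/-- `η_n = f_n''(1) / (2 f_n'(1)^2)`. -/
def etaEnv (Q : ℕ → Ω → Measure ℕ) (n : ℕ) (ω : Ω) : ℝ :=
  (∑' i : ℕ, ((i : ℝ) * ((i : ℝ) - 1)) * (Q n ω {i}).toReal) / (2 * meanQ Q n ω ^ 2)

/-- The associated random walk `S_n = X_1 + ... + X_n`. -/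
def Senv (Q : ℕ → Ω → Measure ℕ) : ℕ → Ω → ℝ := walk (Xenv Q)

/-- The composition `f_{j,n}(s) = f_{j+1}(f_{j+2}(⋯ f_n(s) ⋯))`, with `f_{j,n} = id` for
`n ≤ j`. -/
def pgfComp (Q : ℕ → Ω → Measure ℕ) (j : ℕ) : ℕ → Ω → ℝ → ℝ
  | 0, _, s => s
  | n + 1, ω, s => if n + 1 ≤ j then s else pgfComp Q j n ω (pgf Q (n + 1) ω s)

/-- `b_n = ∑_{i=0}^{n-1} η_{i+1} e^{-S_i}`. -/
def bEnv (Q : ℕ → Ω → Measure ℕ) (n : ℕ) (ω : Ω) : ℝ :=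
  ∑ i ∈ Finset.range n, etaEnv Q (i + 1) ω * Real.exp (-(Senv Q i ω))

/-- `B⁺ = ∑_{i=0}^∞ η_{i+1} e^{-S_i}`. -/
def Bplus (Q : ℕ → Ω → Measure ℕ) (ω : Ω) : ℝ :=
  ∑' i : ℕ, etaEnv Q (i + 1) ω * Real.exp (-(Senv Q i ω))

/-- `B⁻ = ∑_{i=1}^∞ η_i e^{S_i}`. -/
def Bminus (Q : ℕ → Ω → Measure ℕ) (ω : Ω) : ℝ :=
  ∑' i : ℕ, etaEnv Q (i + 1) ω * Real.exp (Senv Q (i + 1) ω)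

/-- `V_∞(r) = 1 / (B⁻ + (1 - r)⁻¹)`. -/
def Vinf (Q : ℕ → Ω → Measure ℕ) (r : ℝ) (ω : Ω) : ℝ := (Bminus Q ω + (1 - r)⁻¹)⁻¹

/-- All the offspring generating functions are fractional linear:
`1/(1 - f_n(s)) = e^{-X_n}/(1-s) + η_n`. -/
def FracLinear (Q : ℕ → Ω → Measure ℕ) : Prop :=
  ∀ n, 1 ≤ n → ∀ ω : Ω, ∀ s : ℝ, 0 ≤ s → s < 1 →
    (1 - pgf Q n ω s)⁻¹ = Real.exp (-(Xenv Q n ω)) / (1 - s) + etaEnv Q n ω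

/-- Assumption A1 with explicit constant `χ`. -/
def AssumptionA1With (μ : Measure Ω) (Q : ℕ → Ω → Measure ℕ) (χ : ℝ) : Prop :=
  0 < χ ∧ χ < 1 / 2 ∧ ∀ n, 1 ≤ n →
    ∀ᵐ ω ∂μ, χ ≤ pgf Q n ω 0 ∧ pgf Q n ω 0 ≤ 1 - χ ∧ χ ≤ etaEnv Q n ω

/-- Assumption A1: for some `χ ∈ (0,1/2)`, `χ ≤ f(0) ≤ 1 - χ` and `η ≥ χ` a.s. -/
def AssumptionA1 (μ : Measure Ω) (Q : ℕ → Ω → Measure ℕ) : Prop :=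
  ∃ χ : ℝ, AssumptionA1With μ Q χ

/-- Assumption A2: `X` has zero mean, finite positive variance and is non-lattice. -/
def AssumptionA2 (μ : Measure Ω) (Q : ℕ → Ω → Measure ℕ) : Prop :=
  Integrable (Xenv Q 1) μ ∧ (∫ ω, Xenv Q 1 ω ∂μ) = 0 ∧
    Integrable (fun ω => Xenv Q 1 ω ^ 2) μ ∧ 0 < ∫ ω, Xenv Q 1 ω ^ 2 ∂μ ∧
    NonLattice (μ.map (Xenv Q 1))

/-- `ζ(a) = ∑_{y ≥ a} y² Q({y}) / m(Q)²`. -/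
def zetaEnv (Q : ℕ → Ω → Measure ℕ) (a : ℕ) (ω : Ω) : ℝ :=
  (∑' y : ℕ, if a ≤ y then (y : ℝ) ^ 2 * (Q 1 ω {y}).toReal else 0) / meanQ Q 1 ω ^ 2

/-- Assumption A3: `E[(log⁺ ζ(a))^{2+ε}] < ∞` for some `ε > 0`, `a ∈ ℕ`. -/
def AssumptionA3 (μ : Measure Ω) (Q : ℕ → Ω → Measure ℕ) : Prop :=
  ∃ ε : ℝ, 0 < ε ∧ ∃ a : ℕ, 1 ≤ a ∧
    Integrable (fun ω => Real.log (max (zetaEnv Q a ω) 1) ^ (2 + ε)) μ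

/-- The extinction moment `T = min {k ≥ 0 : Z_k = 0}`. -/
def extinctTime (Z : ℕ → Ω → ℕ) (ω : Ω) : ℕ := sInf {k | Z k ω = 0}

/-- The branching property of `Z` in the environment `Q` (started from one particle):
given the environment and `Z_k`, the conditional generating function of `Z_n` is
`f_{k,n}(s)^{Z_k}`; the state `0` is absorbing. -/
def BranchingProperty (μ : Measure Ω) (Q : ℕ → Ω → Measure ℕ) (Z : ℕ → Ω → ℕ) : Prop :=
  (∀ ω, Z 0 ω = 1) ∧ (∀ n, Measurable (Z n)) ∧ (∀ n ω, Z n ω = 0 → Z (n + 1) ω = 0) ∧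
    ∀ k n : ℕ, k ≤ n → ∀ s : ℝ, 0 ≤ s → s ≤ 1 →
      (μ[fun ω => s ^ Z n ω | envSigma Q ⊔ MeasurableSpace.comap (Z k) inferInstance])
        =ᵐ[μ] fun ω => pgfComp Q k n ω s ^ Z k ω



/-! ### Random walks on the space of i.i.d. sequences -/

/-- The law of an i.i.d. sequence with marginal `ρ`. -/
def seqLaw {E : Type*} [MeasurableSpace E] (ρ : Measure E) [IsProbabilityMeasure ρ] :
    Measure (ℕ → E) :=
  Measure.infinitePi fun _ => ρ

instance {E : Type*} [MeasurableSpace E] (ρ : Measure E) [IsProbabilityMeasure ρ] :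
    IsProbabilityMeasure (seqLaw ρ) := by
  unfold seqLaw; infer_instance

/-- The first `k` terms of `x`, followed by the sequence `y`. -/
def splice {E : Type*} (k : ℕ) (x y : ℕ → E) (i : ℕ) : E := if i < k then x i else y (i - k)

/-- The walk with steps `X (x 0), X (x 1), …`. -/
def pathSum {E : Type*} (X : E → ℝ) (n : ℕ) (x : ℕ → E) : ℝ := ∑ i ∈ Finset.range n, X (x i)

section Splice

variable {E : Type*}

@[simp] lemma pathSum_zero (X : E → ℝ) (x : ℕ → E) : pathSum X 0 x = 0 := by simp [pathSum]

lemma pathSum_succ (X : E → ℝ) (n : ℕ) (x : ℕ → E) :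
    pathSum X (n + 1) x = pathSum X n x + X (x n) := by
  simp [pathSum, Finset.sum_range_succ]

lemma pathSum_neg (X : E → ℝ) (n : ℕ) (x : ℕ → E) :
    pathSum (fun e => -X e) n x = -pathSum X n x := by
  simp [pathSum]

lemma pathSum_one (X : E → ℝ) (x : ℕ → E) : pathSum X 1 x = X (x 0) := by simp [pathSum]

lemma pathSum_splice_of_le (X : E → ℝ) {j k : ℕ} (h : j ≤ k) (x y : ℕ → E) :
    pathSum X j (splice k x y) = pathSum X j x := by
  refine Finset.sum_congr rfl fun i hi => ?_
  rw [splice, if_pos (lt_of_lt_of_le (Finset.mem_range.1 hi) h)]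

lemma pathSum_splice_add (X : E → ℝ) (k m : ℕ) (x y : ℕ → E) :
    pathSum X (k + m) (splice k x y) = pathSum X k x + pathSum X m y := by
  induction m with
  | zero => simp [pathSum_splice_of_le]
  | succ m ih => rw [← add_assoc, pathSum_succ, ih, pathSum_succ]; simp [splice]; ring

lemma splice_add (k m : ℕ) (x y : ℕ → E) : splice k x y (k + m) = y m := by simp [splice]

/-- Reversal of the first `k` indices. -/
def revIndex (k i : ℕ) : ℕ := if i < k then k - 1 - i else i

lemma revIndex_injective (k : ℕ) : Function.Injective (revIndex k) := by
  intro i j h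
  simp only [revIndex] at h
  split_ifs at h <;> omega

lemma pathSum_revIndex (X : E → ℝ) {j k : ℕ} (h : j ≤ k) (x : ℕ → E) :
    pathSum X j (fun i => x (revIndex k i)) = pathSum X k x - pathSum X (k - j) x := by
  induction j with
  | zero => simp
  | succ j ih =>
    rw [pathSum_succ, ih (by omega)]
    have : k - j = (k - (j + 1)) + 1 := by omega
    rw [this, pathSum_succ]
    have h2 : revIndex k j = k - (j + 1) := by
      simp only [revIndex]; split_ifs <;> omega
    rw [h2]; ring

variable [MeasurableSpace E]

@[fun_prop]
lemma measurable_pathSum {X : E → ℝ} (hX : Measurable X) (n : ℕ) :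
    Measurable (pathSum X n) := by
  unfold pathSum; fun_prop

lemma measurable_splice (k : ℕ) :
    Measurable fun p : (ℕ → E) × (ℕ → E) => splice k p.1 p.2 := by
  refine measurable_pi_lambda _ fun i => ?_
  simp only [splice]
  split_ifs <;> fun_prop

lemma measurable_splice_right (k : ℕ) (x : ℕ → E) : Measurable fun y => splice k x y :=
  (measurable_splice k).comp (measurable_const.prodMk measurable_id)

variable (ρ : Measure E) [IsProbabilityMeasure ρ]

lemma map_splice (k : ℕ) :
    ((seqLaw ρ).prod (seqLaw ρ)).map (fun p => splice k p.1 p.2) = seqLaw ρ := by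
  refine Measure.eq_infinitePi _ fun s t ht => ?_
  have hms : MeasurableSet (Set.pi (s : Set ℕ) t) :=
    MeasurableSet.pi s.countable_toSet fun i _ => ht i
  rw [Measure.map_apply (measurable_splice k) hms]
  have hpre : (fun p : (ℕ → E) × (ℕ → E) => splice k p.1 p.2) ⁻¹' Set.pi (s : Set ℕ) t =
      (Set.pi ((s.filter (· < k) : Finset ℕ) : Set ℕ) t) ×ˢ
        (Set.pi (((s.filter (¬ · < k)).image (· - k) : Finset ℕ) : Set ℕ)
          fun i => t (i + k)) := by
    ext p
    simp only [Set.mem_preimage, Set.mem_pi, Set.mem_prod, Finset.coe_filter, Finset.coe_image,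
      Set.mem_ofPred_eq, Finset.mem_coe, Set.mem_image]
    constructor
    · intro h
      refine ⟨fun i hi => ?_, ?_⟩
      · simpa [splice, hi.2] using h i hi.1
      · rintro _ ⟨j, hj, rfl⟩
        have := h j hj.1
        rw [splice, if_neg hj.2] at this
        rwa [Nat.sub_add_cancel (by omega)]
    · rintro ⟨h1, h2⟩ i hi
      by_cases hik : i < k
      · simpa [splice, hik] using h1 i ⟨hi, hik⟩
      · have := h2 (i - k) ⟨i, ⟨hi, hik⟩, rfl⟩
        rw [Nat.sub_add_cancel (by omega)] at this
        simpa [splice, hik] using this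
  rw [hpre, Measure.prod_prod, seqLaw, Measure.infinitePi_pi _ (fun i _ => ht i),
    Measure.infinitePi_pi _ (fun i _ => ht _), Finset.prod_image,
    ← Finset.prod_filter_mul_prod_filter_not s (· < k)]
  · congr 1
    refine Finset.prod_congr rfl fun i hi => ?_
    rw [Nat.sub_add_cancel (by have := (Finset.mem_filter.1 hi).2; omega)]
  · intro i hi j hj h
    have := (Finset.mem_filter.1 hi).2
    have := (Finset.mem_filter.1 hj).2
    simp only at h
    omega

lemma lintegral_splice (k : ℕ) {f : (ℕ → E) → ENNReal} (hf : Measurable f) :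
    ∫⁻ x, f x ∂seqLaw ρ = ∫⁻ x, ∫⁻ y, f (splice k x y) ∂seqLaw ρ ∂seqLaw ρ := by
  conv_lhs => rw [← map_splice ρ k]
  rw [lintegral_map hf (measurable_splice k), lintegral_prod]
  exact (hf.comp (measurable_splice k)).aemeasurable

lemma measure_splice (k : ℕ) {R : Set (ℕ → E)} (hR : MeasurableSet R) :
    seqLaw ρ R = ∫⁻ x, seqLaw ρ {y | splice k x y ∈ R} ∂seqLaw ρ := by
  rw [← lintegral_indicator_one hR, lintegral_splice ρ k (measurable_one.indicator hR)]
  refine lintegral_congr fun x => ?_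
  exact lintegral_indicator_one (hR.preimage (measurable_splice_right k x))

lemma map_revIndex (k : ℕ) :
    (seqLaw ρ).map (fun x i => x (revIndex k i)) = seqLaw ρ :=
  Measure.map_infinitePi_infinitePi_of_inj (P := fun _ : ℕ => ρ) (revIndex_injective k)

lemma measure_revIndex (k : ℕ) {R : Set (ℕ → E)} (hR : MeasurableSet R) :
    seqLaw ρ {x | (fun i => x (revIndex k i)) ∈ R} = seqLaw ρ R := by
  conv_rhs => rw [← map_revIndex ρ k]
  rw [Measure.map_apply (by fun_prop) hR]
  rfl

lemma map_eval_seqLaw (i : ℕ) : (seqLaw ρ).map (fun x => x i) = ρ :=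
  Measure.infinitePi_map_eval (fun _ : ℕ => ρ) i

end Splice

section Decomposition

variable {E : Type*} [MeasurableSpace E] (ρ : Measure E) [IsProbabilityMeasure ρ]

lemma tsum_sum_antidiagonal (f : ℕ × ℕ → ENNReal) :
    ∑' n, ∑ p ∈ Finset.HasAntidiagonal.antidiagonal n, f p = ∑' k, ∑' m, f (k, m) := by
  rw [← ENNReal.tsum_prod, ← Finset.HasAntidiagonal.sigmaAntidiagonalEquivProd.tsum_eq,
    ENNReal.tsum_sigma']
  refine tsum_congr fun n => ?_
  rw [← Finset.tsum_subtype]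
  rfl

lemma tsum_measure_splice {T : ℕ → ℕ → Set (ℕ → E)} (hT : ∀ k m, MeasurableSet (T k m)) (k : ℕ) :
    ∑' m, seqLaw ρ (T k m) =
      ∫⁻ x, ∑' m, seqLaw ρ {y | splice k x y ∈ T k m} ∂seqLaw ρ := by
  rw [lintegral_tsum]
  · exact tsum_congr fun m => measure_splice ρ k (hT k m)
  · intro m
    exact (measurable_measure_prodMk_left ((hT k m).preimage (measurable_splice k))).aemeasurable

lemma tsum_measure_le_of_splice {R F : ℕ → Set (ℕ → E)} {T : ℕ → ℕ → Set (ℕ → E)}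
    {c : ENNReal} (hT : ∀ k m, MeasurableSet (T k m)) (hF : ∀ k, MeasurableSet (F k))
    (hR : ∀ n, ∀ x ∈ R n, ∃ k m, k + m = n ∧ x ∈ T k m)
    (hb : ∀ k x, ∑' m, seqLaw ρ {y | splice k x y ∈ T k m} ≤ (F k).indicator (fun _ => c) x) :
    ∑' n, seqLaw ρ (R n) ≤ c * ∑' k, seqLaw ρ (F k) := by
  calc ∑' n, seqLaw ρ (R n)
      ≤ ∑' n, ∑ p ∈ Finset.HasAntidiagonal.antidiagonal n, seqLaw ρ (T p.1 p.2) := by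
        refine ENNReal.tsum_le_tsum fun n => ?_
        refine le_trans (measure_mono fun x hx => ?_) (measure_biUnion_finset_le _ _)
        obtain ⟨k, m, hkm, hx⟩ := hR n x hx
        simp only [Set.mem_iUnion]
        exact ⟨(k, m), Finset.HasAntidiagonal.mem_antidiagonal.2 hkm, hx⟩
    _ = ∑' k, ∑' m, seqLaw ρ (T k m) :=
        tsum_sum_antidiagonal fun p => seqLaw ρ (T p.1 p.2)
    _ ≤ ∑' k, c * seqLaw ρ (F k) := by
        refine ENNReal.tsum_le_tsum fun k => ?_
        rw [tsum_measure_splice ρ hT, ← lintegral_indicator_const (hF k)]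
        exact lintegral_mono fun x => hb k x
    _ = c * ∑' k, seqLaw ρ (F k) := ENNReal.tsum_mul_left

lemma le_tsum_measure_of_splice {R F : ℕ → Set (ℕ → E)} {T : ℕ → ℕ → Set (ℕ → E)}
    {c : ENNReal} (hT : ∀ k m, MeasurableSet (T k m)) (hF : ∀ k, MeasurableSet (F k))
    (hR : ∀ k m, T k m ⊆ R (k + m))
    (hdisj : ∀ k m k' m', k ≠ k' → Disjoint (T k m) (T k' m'))
    (hb : ∀ k x, (F k).indicator (fun _ => c) x ≤ ∑' m, seqLaw ρ {y | splice k x y ∈ T k m}) :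
    c * ∑' k, seqLaw ρ (F k) ≤ ∑' n, seqLaw ρ (R n) := by
  calc c * ∑' k, seqLaw ρ (F k) = ∑' k, c * seqLaw ρ (F k) := ENNReal.tsum_mul_left.symm
    _ ≤ ∑' k, ∑' m, seqLaw ρ (T k m) := by
        refine ENNReal.tsum_le_tsum fun k => ?_
        rw [tsum_measure_splice ρ hT, ← lintegral_indicator_const (hF k)]
        exact lintegral_mono fun x => hb k x
    _ = ∑' n, ∑ p ∈ Finset.HasAntidiagonal.antidiagonal n, seqLaw ρ (T p.1 p.2) :=
        (tsum_sum_antidiagonal fun p => seqLaw ρ (T p.1 p.2)).symm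
    _ ≤ ∑' n, seqLaw ρ (R n) := by
        refine ENNReal.tsum_le_tsum fun n => ?_
        rw [← measure_biUnion_finset _ fun p _ => hT _ _]
        · refine measure_mono (Set.iUnion₂_subset fun p hp => ?_)
          rw [← Finset.HasAntidiagonal.mem_antidiagonal.1 hp]
          exact hR _ _
        · intro p hp q hq hpq
          have hp' := Finset.HasAntidiagonal.mem_antidiagonal.1 hp
          have hq' := Finset.HasAntidiagonal.mem_antidiagonal.1 hq
          refine hdisj _ _ _ _ fun h => hpq (Prod.ext h ?_)
          omega

lemma tsum_measure_le_one {F : ℕ → Set (ℕ → E)} (hF : ∀ k, MeasurableSet (F k))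
    (hdisj : ∀ j k, j < k → Disjoint (F j) (F k)) : ∑' k, seqLaw ρ (F k) ≤ 1 := by
  rw [← measure_iUnion _ hF]
  · exact prob_le_one
  · intro j k hjk
    rcases lt_or_gt_of_ne hjk with h | h
    · exact hdisj j k h
    · exact (hdisj k j h).symm

end Decomposition

/-! ### Green functions of killed random walks -/

section Green

variable {E : Type*}

/-- The walk started at `y` stays in `A` during the steps `1, …, n`. -/
def stay (X : E → ℝ) (A : Set ℝ) (n : ℕ) (y : ℝ) : Set (ℕ → E) :=
  {x | ∀ j ∈ Finset.Icc 1 n, y + pathSum X j x ∈ A}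

/-- The time `n` is a record time, where the increments from earlier times have to be in `A`. -/
def record (X : E → ℝ) (A : Set ℝ) (n : ℕ) : Set (ℕ → E) :=
  {x | ∀ i < n, pathSum X n x - pathSum X i x ∈ A}

/-- The half-line complementary to `A`, reflected at the origin. -/
def dualHalf (A : Set ℝ) : Set ℝ := {a | -a ∉ A}

/-- The sequence `x` without its first `k` terms. -/
def shiftSeq (k : ℕ) (x : ℕ → E) : ℕ → E := fun i => x (k + i)

/-- `A` is the closed or the open positive half-line. -/
def IsPosHalf (A : Set ℝ) : Prop := A = Ici 0 ∨ A = Ioi 0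

lemma IsPosHalf.measurableSet {A : Set ℝ} (hA : IsPosHalf A) : MeasurableSet A := by
  rcases hA with rfl | rfl <;> measurability

lemma IsPosHalf.nonneg {A : Set ℝ} (hA : IsPosHalf A) {a : ℝ} (ha : a ∈ A) : 0 ≤ a := by
  rcases hA with rfl | rfl
  · exact ha
  · exact le_of_lt ha

lemma IsPosHalf.mem_of_pos {A : Set ℝ} (hA : IsPosHalf A) {a : ℝ} (ha : 0 < a) : a ∈ A := by
  rcases hA with rfl | rfl
  · exact ha.le
  · exact ha

lemma IsPosHalf.add_mem {A : Set ℝ} (hA : IsPosHalf A) {a b : ℝ} (ha : a ∈ A) (hb : 0 ≤ b) :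
    a + b ∈ A := by
  rcases hA with rfl | rfl
  · exact add_nonneg ha hb
  · exact add_pos_of_pos_of_nonneg ha hb

lemma IsPosHalf.sub_notMem {A : Set ℝ} (hA : IsPosHalf A) {a b : ℝ} (ha : a ∉ A) (hb : 0 ≤ b) :
    a - b ∉ A := fun h => ha (by simpa using hA.add_mem h hb)

lemma IsPosHalf.nonpos_of_notMem {A : Set ℝ} (hA : IsPosHalf A) {a : ℝ} (ha : a ∉ A) : a ≤ 0 := by
  by_contra h
  exact ha (hA.mem_of_pos (not_le.1 h))

lemma IsPosHalf.dualHalf {A : Set ℝ} (hA : IsPosHalf A) : IsPosHalf (dualHalf A) := by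
  rcases hA with rfl | rfl
  · right; ext a; simp [BPREpaper.dualHalf]
  · left; ext a; simp [BPREpaper.dualHalf]

lemma mem_dualHalf {A : Set ℝ} {a : ℝ} : a ∈ dualHalf A ↔ -a ∉ A := Iff.rfl

@[simp] lemma shiftSeq_splice (k : ℕ) (x y : ℕ → E) : shiftSeq k (splice k x y) = y := by
  funext i; simp [shiftSeq, splice_add]

lemma pathSum_shiftSeq (X : E → ℝ) (k m : ℕ) (x : ℕ → E) :
    pathSum X m (shiftSeq k x) = pathSum X (k + m) x - pathSum X k x := by
  simp [pathSum, shiftSeq, Finset.sum_range_add]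

lemma record_splice (X : E → ℝ) (A : Set ℝ) {j k : ℕ} (h : j ≤ k) (x y : ℕ → E) :
    splice k x y ∈ record X A j ↔ x ∈ record X A j := by
  refine forall₂_congr fun i hi => ?_
  rw [pathSum_splice_of_le X h, pathSum_splice_of_le X (by omega)]

lemma stay_splice (X : E → ℝ) (A : Set ℝ) {j k : ℕ} (h : j ≤ k) (a : ℝ) (x y : ℕ → E) :
    splice k x y ∈ stay X A j a ↔ x ∈ stay X A j a := by
  refine forall₂_congr fun i hi => ?_
  rw [pathSum_splice_of_le X ((Finset.mem_Icc.1 hi).2.trans h)]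

lemma revIndex_mem_stay (X : E → ℝ) (A : Set ℝ) (n : ℕ) (x : ℕ → E) :
    (fun i => x (revIndex n i)) ∈ stay X A n 0 ↔ x ∈ record X A n := by
  constructor
  · intro h i hi
    have := h (n - i) (Finset.mem_Icc.2 ⟨by omega, by omega⟩)
    rwa [zero_add, pathSum_revIndex X (by omega), Nat.sub_sub_self hi.le] at this
  · intro h j hj
    have hj := Finset.mem_Icc.1 hj
    rw [zero_add, pathSum_revIndex X hj.2]
    exact h _ (by omega)

lemma nonneg_of_mem_record {X : E → ℝ} {A : Set ℝ} (hA : IsPosHalf A) {n : ℕ} {x : ℕ → E}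
    (h : x ∈ record X A n) : 0 ≤ pathSum X n x := by
  rcases Nat.eq_zero_or_pos n with rfl | hn
  · simp
  · simpa using hA.nonneg (h 0 hn)

/-- Decomposition of a path at a minimum. -/
lemma exists_record_stay (X : E → ℝ) {A : Set ℝ} (hA : IsPosHalf A) (n : ℕ) (x : ℕ → E) :
    ∃ k ≤ n, x ∈ record (fun e => -X e) (dualHalf A) k ∧
      ∀ j, k < j → j ≤ n → pathSum X j x - pathSum X k x ∈ A := by
  induction n with
  | zero => exact ⟨0, le_rfl, fun i hi => absurd hi (by omega), fun j h1 h2 => by omega⟩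
  | succ n ih =>
    obtain ⟨k, hk, hrec, hst⟩ := ih
    by_cases h : pathSum X (n + 1) x - pathSum X k x ∈ A
    · refine ⟨k, by omega, hrec, fun j h1 h2 => ?_⟩
      rcases Nat.lt_or_eq_of_le h2 with h3 | rfl
      · exact hst j h1 (by omega)
      · exact h
    · refine ⟨n + 1, le_rfl, fun i hi => ?_, fun j h1 h2 => by omega⟩
      rw [pathSum_neg, pathSum_neg, mem_dualHalf]
      rcases lt_trichotomy i k with h1 | rfl | h1
      · have h2 := hrec i h1
        rw [pathSum_neg, pathSum_neg, mem_dualHalf] at h2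
        have h3 := hA.nonpos_of_notMem h2
        have h5 := hA.sub_notMem h (b := pathSum X i x - pathSum X k x) (by linarith)
        rwa [show ∀ a b c : ℝ, a - b - (c - b) = -(-a - -c) by intros; ring] at h5
      · rwa [show ∀ a b : ℝ, -(-a - -b) = a - b by intros; ring]
      · have h3 := hA.nonneg (hst i h1 (by omega))
        have h5 := hA.sub_notMem h (b := pathSum X i x - pathSum X k x) (by linarith)
        rwa [show ∀ a b c : ℝ, a - b - (c - b) = -(-a - -c) by intros; ring] at h5

variable [MeasurableSpace E]

@[fun_prop]
lemma measurable_shiftSeq (k : ℕ) : Measurable (shiftSeq k : (ℕ → E) → ℕ → E) := by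
  unfold shiftSeq; fun_prop

lemma measurableSet_stay {X : E → ℝ} (hX : Measurable X) {A : Set ℝ} (hA : IsPosHalf A)
    (n : ℕ) (y : ℝ) : MeasurableSet (stay X A n y) := by
  have : stay X A n y = ⋂ j ∈ Finset.Icc 1 n, {x | y + pathSum X j x ∈ A} := by
    ext x; simp [stay]
  rw [this]
  refine Finset.measurableSet_biInter _ fun j _ => ?_
  exact hA.measurableSet.preimage ((measurable_pathSum hX j).const_add y)

lemma measurableSet_record {X : E → ℝ} (hX : Measurable X) {A : Set ℝ} (hA : IsPosHalf A)
    (n : ℕ) : MeasurableSet (record X A n) := by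
  have : record X A n = ⋂ j ∈ Finset.range n, {x | pathSum X n x - pathSum X j x ∈ A} := by
    ext x; simp [record]
  rw [this]
  refine Finset.measurableSet_biInter _ fun j _ => ?_
  exact hA.measurableSet.preimage ((measurable_pathSum hX n).sub (measurable_pathSum hX j))

variable (ρ : Measure E) [IsProbabilityMeasure ρ]

/-- The expected number of visits to `B` of the walk started at `y` and killed outside `A`. -/
def green (X : E → ℝ) (A : Set ℝ) (y : ℝ) (B : Set ℝ) : ENNReal :=
  ∑' n, seqLaw ρ {x | x ∈ stay X A n y ∧ y + pathSum X n x ∈ B}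

variable {X : E → ℝ} {A : Set ℝ}

lemma green_mono (y : ℝ) {B C : Set ℝ} (h : B ⊆ C) : green ρ X A y B ≤ green ρ X A y C :=
  ENNReal.tsum_le_tsum fun _ => measure_mono fun _ hx => ⟨hx.1, h hx.2⟩

lemma green_union_le (y : ℝ) (B C : Set ℝ) :
    green ρ X A y (B ∪ C) ≤ green ρ X A y B + green ρ X A y C := by
  unfold green
  rw [← ENNReal.tsum_add]
  refine ENNReal.tsum_le_tsum fun n => le_trans (measure_mono ?_) (measure_union_le _ _)
  rintro x ⟨h1, h2 | h2⟩
  · exact Or.inl ⟨h1, h2⟩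
  · exact Or.inr ⟨h1, h2⟩

lemma measure_stay_eq_record (hX : Measurable X) (hA : IsPosHalf A) {B : Set ℝ}
    (hB : MeasurableSet B) (n : ℕ) :
    seqLaw ρ {x | x ∈ stay X A n 0 ∧ 0 + pathSum X n x ∈ B} =
      seqLaw ρ {x | x ∈ record X A n ∧ pathSum X n x ∈ B} := by
  have hm : MeasurableSet {x | x ∈ stay X A n 0 ∧ 0 + pathSum X n x ∈ B} :=
    (measurableSet_stay hX hA n 0).inter (hB.preimage ((measurable_pathSum hX n).const_add 0))
  rw [← measure_revIndex ρ n hm]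
  congr 1
  ext x
  simp only [Set.mem_ofPred_eq, revIndex_mem_stay, zero_add, pathSum_revIndex X le_rfl]
  simp

lemma green_zero_eq (hX : Measurable X) (hA : IsPosHalf A) {B : Set ℝ}
    (hB : MeasurableSet B) :
    green ρ X A 0 B = ∑' n, seqLaw ρ {x | x ∈ record X A n ∧ pathSum X n x ∈ B} :=
  tsum_congr fun n => measure_stay_eq_record ρ hX hA hB n

lemma green_zero_inter_nonneg (hA : IsPosHalf A) (B : Set ℝ) :
    green ρ X A 0 B = green ρ X A 0 (B ∩ Ici 0) := by
  refine tsum_congr fun n => ?_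
  congr 1
  ext x
  simp only [Set.mem_ofPred_eq, mem_inter_iff, mem_Ici]
  constructor
  · rintro ⟨h1, h2⟩
    refine ⟨h1, h2, ?_⟩
    rcases Nat.eq_zero_or_pos n with rfl | hn
    · simp
    · exact hA.nonneg (h1 n (Finset.mem_Icc.2 ⟨hn, le_rfl⟩))
  · rintro ⟨h1, h2, _⟩
    exact ⟨h1, h2⟩

lemma measurableSet_record_inter (hX : Measurable X) (hA : IsPosHalf A) {B : Set ℝ}
    (hB : MeasurableSet B) (n : ℕ) :
    MeasurableSet {x | x ∈ record X A n ∧ pathSum X n x ∈ B} :=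
  (measurableSet_record hX hA n).inter (hB.preimage (measurable_pathSum hX n))

lemma green_window_le (hX : Measurable X) (hA : IsPosHalf A) (a b : ℝ) :
    green ρ X A 0 (Ico a (a + b)) ≤ green ρ X A 0 (Ico 0 b) := by
  set R : ℕ → Set (ℕ → E) := fun n => {x | x ∈ record X A n ∧ pathSum X n x ∈ Ico a (a + b)}
    with hRdef
  set H : ℕ → Set (ℕ → E) := fun n => {x | x ∈ record X A n ∧ pathSum X n x ∈ Ico 0 b}
    with hHdef
  have hR : ∀ n, MeasurableSet (R n) := measurableSet_record_inter hX hA measurableSet_Ico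
  have hH : ∀ n, MeasurableSet (H n) := measurableSet_record_inter hX hA measurableSet_Ico
  set F : ℕ → Set (ℕ → E) := fun k => R k \ ⋃ i ∈ Finset.range k, R i with hFdef
  have hF : ∀ k, MeasurableSet (F k) := fun k =>
    (hR k).diff (Finset.measurableSet_biUnion _ fun i _ => hR i)
  have hRs : ∀ {j k : ℕ}, j ≤ k → ∀ x y, splice k x y ∈ R j ↔ x ∈ R j := fun h x y => by
    simp only [hRdef, Set.mem_ofPred_eq, record_splice X A h, pathSum_splice_of_le X h]
  have hFs : ∀ k x y, splice k x y ∈ F k ↔ x ∈ F k := fun k x y => by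
    simp only [hFdef, Set.mem_sdiff, Set.mem_iUnion, Finset.mem_range, exists_prop, hRs le_rfl]
    refine and_congr_right fun _ => not_congr (exists_congr fun i => and_congr_right fun hi => ?_)
    exact hRs hi.le x y
  rw [green_zero_eq ρ hX hA measurableSet_Ico, green_zero_eq ρ hX hA measurableSet_Ico]
  refine le_trans (tsum_measure_le_of_splice ρ (R := R) (F := F)
    (T := fun k m => F k ∩ shiftSeq k ⁻¹' H m) (c := ∑' n, seqLaw ρ (H n))
    (fun k m => (hF k).inter ((hH m).preimage (measurable_shiftSeq k))) hF ?_ ?_) ?_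
  · classical
    intro n x hx
    have hex : ∃ k, x ∈ R k := ⟨n, hx⟩
    have hk := Nat.find_spec hex
    have hkn := Nat.find_min' hex hx
    set k := Nat.find hex
    refine ⟨k, n - k, by omega, ⟨hk, ?_⟩, ?_, ?_⟩
    · simp only [Set.mem_iUnion, Finset.mem_range, exists_prop, not_exists, not_and]
      exact fun i hi => Nat.find_min hex hi
    · intro i hi
      rw [pathSum_shiftSeq, pathSum_shiftSeq]
      have := hx.1 (k + i) (by omega)
      rw [show k + (n - k) = n by omega]
      convert this using 1; ring
    · rw [pathSum_shiftSeq, show k + (n - k) = n by omega]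
      have h1 := hx.2
      have h2 := hk.2
      simp only [mem_Ico] at h1 h2 ⊢
      refine ⟨?_, by linarith⟩
      rcases Nat.lt_or_eq_of_le hkn with h3 | h3
      · exact hA.nonneg (hx.1 k h3)
      · rw [h3]; simp
  · intro k x
    by_cases hx : x ∈ F k
    · rw [Set.indicator_of_mem hx]
      refine ENNReal.tsum_le_tsum fun m => measure_mono fun y hy => ?_
      simpa using hy.2
    · rw [Set.indicator_of_notMem hx, nonpos_iff_eq_zero, ENNReal.tsum_eq_zero]
      intro m
      rw [show {y | splice k x y ∈ F k ∩ shiftSeq k ⁻¹' H m} = ∅ from ?_, measure_empty]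
      ext y
      simp [hFs, hx]
  · refine mul_le_of_le_one_right' (tsum_measure_le_one ρ hF fun j k hjk => ?_)
    refine Set.disjoint_left.2 fun x hxj hxk => hxk.2 ?_
    exact Set.mem_biUnion (Finset.mem_coe.2 (Finset.mem_range.2 hjk)) hxj.1

/-- Decomposition at the minimum, in terms of Green functions. -/
lemma green_le_mul (hX : Measurable X) (hA : IsPosHalf A) {y : ℝ} (hy : 0 ≤ y) (c b : ℝ) :
    green ρ X A y (Ico c (c + b)) ≤
      green ρ X A 0 (Ico 0 b) *
        green ρ (fun e => -X e) (dualHalf A) 0 (Ioc (y - c - b) y) := by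
  set R : ℕ → Set (ℕ → E) := fun n => {x | x ∈ stay X A n y ∧ y + pathSum X n x ∈ Ico c (c + b)}
    with hRdef
  set F : ℕ → Set (ℕ → E) := fun k => {x | x ∈ record (fun e => -X e) (dualHalf A) k ∧
    pathSum (fun e => -X e) k x ∈ Ioc (y - c - b) y} with hFdef
  have hF : ∀ k, MeasurableSet (F k) :=
    measurableSet_record_inter hX.neg hA.dualHalf measurableSet_Ioc
  have hFs : ∀ k x z, splice k x z ∈ F k ↔ x ∈ F k := fun k x z => by
    simp only [hFdef, Set.mem_ofPred_eq, record_splice _ _ le_rfl, pathSum_splice_of_le _ le_rfl]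
  set T : ℕ → ℕ → Set (ℕ → E) := fun k m => F k ∩ {x | shiftSeq k x ∈ stay X A m 0 ∧
    y + pathSum X k x + pathSum X m (shiftSeq k x) ∈ Ico c (c + b)} with hTdef
  have hT : ∀ k m, MeasurableSet (T k m) := by
    intro k m
    refine (hF k).inter (MeasurableSet.inter ?_ ?_)
    · exact (measurableSet_stay hX hA m 0).preimage (measurable_shiftSeq k)
    · refine measurableSet_Ico.preimage (f := fun x => y + pathSum X k x +
        pathSum X m (shiftSeq k x)) ?_
      exact ((measurable_pathSum hX k).const_add y).add
        ((measurable_pathSum hX m).comp (measurable_shiftSeq k))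
  rw [green_zero_eq ρ (X := fun e => -X e) (by fun_prop) hA.dualHalf measurableSet_Ioc]
  refine tsum_measure_le_of_splice ρ hT hF ?_ ?_
  · intro n x hx
    obtain ⟨k, hkn, hrec, hst⟩ := exists_record_stay X hA n x
    have hk0 : 0 ≤ y + pathSum X k x := by
      rcases Nat.eq_zero_or_pos k with rfl | hk
      · simpa using hy
      · exact hA.nonneg (hx.1 k (Finset.mem_Icc.2 ⟨hk, hkn⟩))
    have hkn' : pathSum X k x ≤ pathSum X n x := by
      rcases Nat.lt_or_eq_of_le hkn with h3 | rfl
      · linarith [hA.nonneg (hst n h3 le_rfl)]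
      · exact le_rfl
    have hx2 : c ≤ y + pathSum X n x ∧ y + pathSum X n x < c + b := hx.2
    refine ⟨k, n - k, by omega, ⟨hrec, ?_⟩, ?_, ?_⟩
    · rw [pathSum_neg, mem_Ioc]
      exact ⟨by linarith, by linarith⟩
    · intro j hj
      have hj := Finset.mem_Icc.1 hj
      rw [pathSum_shiftSeq, zero_add]
      exact hst _ (by omega) (by omega)
    · rw [pathSum_shiftSeq, show k + (n - k) = n by omega, mem_Ico]
      exact ⟨by linarith, by linarith⟩
  · intro k x
    by_cases hx : x ∈ F k
    · rw [Set.indicator_of_mem hx]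
      refine le_trans ?_ (green_window_le ρ hX hA (c - (y + pathSum X k x)) b)
      refine ENNReal.tsum_le_tsum fun m => measure_mono fun z hz => ?_
      have h2 := hz.2
      simp only [Set.mem_ofPred_eq, shiftSeq_splice, pathSum_splice_of_le X le_rfl, mem_Ico] at h2
      refine ⟨h2.1, ?_⟩
      rw [mem_Ico]
      exact ⟨by linarith, by linarith⟩
    · rw [Set.indicator_of_notMem hx, nonpos_iff_eq_zero, ENNReal.tsum_eq_zero]
      intro m
      rw [show {z | splice k x z ∈ T k m} = ∅ from ?_, measure_empty]
      ext z
      simp [hTdef, hFs, hx]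

lemma green_Iic_mul_le_one (hX : Measurable X) (hA : IsPosHalf A) (z : ℝ) :
    green ρ X A 0 (Iic z) * ρ {e | z < X e} ≤ 1 := by
  set R : ℕ → Set (ℕ → E) := fun n => {x | x ∈ record X A n ∧ pathSum X n x ∈ Iic z} with hRdef
  have hR : ∀ n, MeasurableSet (R n) := measurableSet_record_inter hX hA measurableSet_Iic
  have hz : MeasurableSet {e | z < X e} := measurableSet_lt measurable_const hX
  have hRX : ∀ n, MeasurableSet (R n ∩ {x | x n ∈ {e | z < X e}}) := fun n =>
    (hR n).inter (hz.preimage (measurable_pi_apply n))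
  have hprod : ∀ n, seqLaw ρ (R n) * ρ {e | z < X e} =
      seqLaw ρ (R n ∩ {x | x n ∈ {e | z < X e}}) := by
    intro n
    rw [measure_splice ρ n (hRX n), mul_comm, ← lintegral_indicator_const (hR n)]
    refine lintegral_congr fun x => ?_
    have hs : ∀ y, splice n x y ∈ R n ↔ x ∈ R n := fun y => by
      simp only [hRdef, Set.mem_ofPred_eq, record_splice _ _ le_rfl,
        pathSum_splice_of_le _ le_rfl]
    by_cases hx : x ∈ R n
    · rw [Set.indicator_of_mem hx]
      nth_rewrite 1 [← map_eval_seqLaw ρ 0]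
      rw [Measure.map_apply (measurable_pi_apply 0) hz]
      congr 1
      ext y
      simp [hs, hx, splice]
    · rw [Set.indicator_of_notMem hx, eq_comm]
      convert measure_empty (μ := seqLaw ρ)
      ext y
      simp [hs, hx]
  rw [green_zero_eq ρ hX hA measurableSet_Iic, ← ENNReal.tsum_mul_right, tsum_congr hprod]
  refine tsum_measure_le_one ρ hRX fun j k hjk => Set.disjoint_left.2 fun x hxj hxk => ?_
  have h1 : 0 ≤ pathSum X j x := nonneg_of_mem_record hA hxj.1.1
  have h2 : z < X (x j) := hxj.2
  have h3 : pathSum X k x ≤ z := hxk.1.2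
  have h4 := pathSum_succ X j x
  rcases Nat.lt_or_eq_of_le (show j + 1 ≤ k from hjk) with h5 | h5
  · have := hA.nonneg (hxk.1.1 (j + 1) h5)
    linarith
  · rw [← h5] at h3
    linarith

lemma green_Iio_add_le (hX : Measurable X) (hA : IsPosHalf A) (s t : ℝ) :
    green ρ X A 0 (Iio (s + t)) ≤ green ρ X A 0 (Iio s) + green ρ X A 0 (Iio t) := by
  refine le_trans (green_mono ρ 0 (C := Iio s ∪ Ico s (s + t)) ?_)
    (le_trans (green_union_le ρ 0 _ _) (add_le_add le_rfl ?_))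
  · intro w hw
    rcases lt_or_ge w s with h | h
    · exact Or.inl h
    · exact Or.inr ⟨h, hw⟩
  · exact (green_window_le ρ hX hA s t).trans (green_mono ρ 0 fun w hw => hw.2)

lemma green_Iio_nat_mul_le (hX : Measurable X) (hA : IsPosHalf A) (t : ℝ) (n : ℕ) :
    green ρ X A 0 (Iio (n * t)) ≤ n * green ρ X A 0 (Iio t) := by
  induction n with
  | zero =>
    have he : Iio (((0 : ℕ) : ℝ) * t) ∩ Ici 0 = ∅ := by
      ext w; simp
    rw [green_zero_inter_nonneg ρ hA, he]
    simp [green]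
  | succ n ih =>
    push_cast
    rw [add_mul, one_mul, add_mul, one_mul]
    exact (green_Iio_add_le ρ hX hA _ _).trans (by gcongr)

/-- The Green function of a half-line grows at most linearly. -/
lemma exists_green_Iio_le (hX : Measurable X) (hA : IsPosHalf A) (hpos : 0 < ρ {e | 0 < X e}) :
    ∃ C : ℝ, 0 < C ∧ ∀ t : ℝ, 0 ≤ t → green ρ X A 0 (Iio t) ≤ ENNReal.ofReal (C * (1 + t)) := by
  obtain ⟨h, hh, hρ⟩ : ∃ h : ℝ, 0 < h ∧ 0 < ρ {e | h < X e} := by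
    by_contra! hcon
    refine hpos.ne' ?_
    have : {e | 0 < X e} = ⋃ n : ℕ, {e | 1 / ((n : ℝ) + 1) < X e} := by
      ext e
      simp only [Set.mem_ofPred_eq, Set.mem_iUnion]
      exact ⟨fun he => exists_nat_one_div_lt he, fun ⟨n, hn⟩ => lt_trans (by positivity) hn⟩
    rw [this, measure_iUnion_null_iff]
    exact fun n => nonpos_iff_eq_zero.1 (hcon _ (by positivity))
  have hfin : green ρ X A 0 (Iio h) ≠ ⊤ := by
    intro htop
    have h1 := green_Iic_mul_le_one ρ hX hA h
    have h2 : green ρ X A 0 (Iic h) = ⊤ :=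
      top_le_iff.1 (htop ▸ green_mono ρ 0 Iio_subset_Iic_self)
    rw [h2, ENNReal.top_mul hρ.ne'] at h1
    exact absurd h1 (by simp)
  set c := (green ρ X A 0 (Iio h)).toReal with hc
  refine ⟨(c + 1) * (1 + 1 / h), by positivity, fun t ht => ?_⟩
  have hn : t ≤ (⌈t / h⌉₊ : ℝ) * h := by
    rw [← div_le_iff₀ hh]; exact Nat.le_ceil _
  have hn2 : (⌈t / h⌉₊ : ℝ) ≤ t / h + 1 := (Nat.ceil_lt_add_one (by positivity)).le
  calc green ρ X A 0 (Iio t) ≤ green ρ X A 0 (Iio (⌈t / h⌉₊ * h)) :=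
        green_mono ρ 0 (Iio_subset_Iio hn)
    _ ≤ ⌈t / h⌉₊ * green ρ X A 0 (Iio h) := green_Iio_nat_mul_le ρ hX hA h _
    _ = ENNReal.ofReal (⌈t / h⌉₊ * c) := by
        rw [ENNReal.ofReal_mul (by positivity), hc, ENNReal.ofReal_toReal hfin,
          ENNReal.ofReal_natCast]
    _ ≤ ENNReal.ofReal ((c + 1) * (1 + 1 / h) * (1 + t)) := by
        refine ENNReal.ofReal_le_ofReal ?_
        have hc0 : 0 ≤ c := ENNReal.toReal_nonneg
        calc (⌈t / h⌉₊ : ℝ) * c ≤ (t / h + 1) * (c + 1) := by gcongr; linarith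
          _ ≤ (t / h + 1 + (t + 1 / h)) * (c + 1) := 
            mul_le_mul_of_nonneg_right (by
              have : 0 ≤ t + 1 / h := by positivity
              linarith) (by linarith)
          _ = _ := by field_simp; ring

end Green

/-! ### Growth of the Green function of a half-line -/

section Growth

variable {E : Type*} [MeasurableSpace E] (ρ : Measure E) [IsProbabilityMeasure ρ]
variable {X : E → ℝ} {A : Set ℝ}

/-- With a probability bounded away from zero, the walk passes the level `z` before it passes the
level `K * z`, for all large `z`. -/
def PassesLevels (X : E → ℝ) : Prop :=
  ∃ p : ENNReal, 0 < p ∧ ∃ K : ℝ, 1 ≤ K ∧ ∃ z₀ : ℝ, 0 < z₀ ∧ ∀ z, z₀ ≤ z →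
    p ≤ seqLaw ρ {x | ∃ n, z ≤ pathSum X n x ∧ ∀ i ≤ n, pathSum X i x ≤ K * z}

lemma green_Iio_eq_Ico (hA : IsPosHalf A) (z : ℝ) :
    green ρ X A 0 (Iio z) = green ρ X A 0 (Ico 0 z) := by
  rw [green_zero_inter_nonneg ρ hA, Set.inter_comm]
  rfl

lemma green_union (hX : Measurable X) (hA : IsPosHalf A) (y : ℝ) {B C : Set ℝ}
    (hC : MeasurableSet C) (hBC : Disjoint B C) :
    green ρ X A y (B ∪ C) = green ρ X A y B + green ρ X A y C := by
  unfold green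
  rw [← ENNReal.tsum_add]
  refine tsum_congr fun n => ?_
  rw [← measure_union]
  · congr 1
    ext x
    simp only [Set.mem_ofPred_eq, mem_union]
    tauto
  · exact Set.disjoint_left.2 fun x h1 h2 => Set.disjoint_left.1 hBC h1.2 h2.2
  · exact (measurableSet_stay hX hA n y).inter (hC.preimage ((measurable_pathSum hX n).const_add y))

lemma green_window_ge (hX : Measurable X) (hA : IsPosHalf A) {z K : ℝ} :
    green ρ X A 0 (Iio z) *
        seqLaw ρ {x | ∃ n, z ≤ pathSum X n x ∧ ∀ i ≤ n, pathSum X i x ≤ K * z} ≤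
      green ρ X A 0 (Ico z ((K + 1) * z)) := by
  classical
  rw [green_Iio_eq_Ico ρ hA, green_zero_eq ρ hX hA measurableSet_Ico,
    green_zero_eq ρ hX hA measurableSet_Ico]
  set F : ℕ → Set (ℕ → E) := fun k => {x | (∀ i ∈ Finset.range k, pathSum X i x < z) ∧
    z ≤ pathSum X k x ∧ pathSum X k x ≤ K * z} with hFdef
  set H : ℕ → Set (ℕ → E) := fun n => {x | x ∈ record X A n ∧ pathSum X n x ∈ Ico 0 z}
    with hHdef
  have hF : ∀ k, MeasurableSet (F k) := by
    intro k
    have : F k = (⋂ i ∈ Finset.range k, {x | pathSum X i x < z}) ∩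
        ({x | z ≤ pathSum X k x} ∩ {x | pathSum X k x ≤ K * z}) := by
      ext x; simp [hFdef]
    rw [this]
    refine (Finset.measurableSet_biInter _ fun i _ => ?_).inter (MeasurableSet.inter ?_ ?_)
    · exact measurableSet_lt (measurable_pathSum hX i) measurable_const
    · exact measurableSet_le measurable_const (measurable_pathSum hX k)
    · exact measurableSet_le (measurable_pathSum hX k) measurable_const
  have hH : ∀ n, MeasurableSet (H n) := measurableSet_record_inter hX hA measurableSet_Ico
  have hFs : ∀ k x y, splice k x y ∈ F k ↔ x ∈ F k := fun k x y => by
    simp only [hFdef, Set.mem_ofPred_eq, pathSum_splice_of_le X le_rfl]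
    refine and_congr_left fun _ => forall₂_congr fun i hi => ?_
    rw [pathSum_splice_of_le X (Finset.mem_range.1 hi).le]
  have hdisj : ∀ k k', k < k' → Disjoint (F k) (F k') := fun k k' h =>
    Set.disjoint_left.2 fun x h1 h2 =>
      absurd (h2.1 k (Finset.mem_range.2 h)) (not_lt.2 h1.2.1)
  have hdisj' : ∀ k k', k ≠ k' → Disjoint (F k) (F k') := fun k k' h => by
    rcases lt_or_gt_of_ne h with h | h
    · exact hdisj _ _ h
    · exact (hdisj _ _ h).symm
  refine le_trans (mul_le_mul_right (b := seqLaw ρ _) (c := ∑' k, seqLaw ρ (F k)) ?_ _)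
    (le_tsum_measure_of_splice ρ (T := fun k m => F k ∩ shiftSeq k ⁻¹' H m)
      (fun k m => (hF k).inter ((hH m).preimage (measurable_shiftSeq k))) hF ?_ ?_ ?_)
  · refine le_trans (measure_mono ?_) (measure_iUnion_le F)
    rintro x ⟨n, hn, hi⟩
    have hex : ∃ n, z ≤ pathSum X n x := ⟨n, hn⟩
    refine Set.mem_iUnion.2 ⟨Nat.find hex, fun i h => ?_, Nat.find_spec hex,
      hi _ (Nat.find_min' hex hn)⟩
    exact not_le.1 (Nat.find_min hex (Finset.mem_range.1 h))
  · rintro k m x ⟨hx, hrec, hwin⟩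
    rw [pathSum_shiftSeq, mem_Ico] at hwin
    refine ⟨fun i hi => ?_, mem_Ico.2 ⟨by linarith [hx.2.1], by linarith [hx.2.2]⟩⟩
    rcases lt_or_ge i k with h | h
    · have h1 := hx.1 i (Finset.mem_range.2 h)
      have h2 := hx.2.1
      exact hA.mem_of_pos (by linarith)
    · have := hrec (i - k) (by omega)
      rw [pathSum_shiftSeq, pathSum_shiftSeq, show k + (i - k) = i by omega] at this
      simpa using this
  · intro k m k' m' h
    exact (hdisj' k k' h).mono inter_subset_left inter_subset_left
  · intro k x
    by_cases hx : x ∈ F k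
    · rw [Set.indicator_of_mem hx]
      refine ENNReal.tsum_le_tsum fun m => measure_mono fun y hy => ?_
      refine ⟨(hFs k x y).2 hx, ?_⟩
      rw [mem_preimage, shiftSeq_splice]
      exact hy
    · rw [Set.indicator_of_notMem hx]
      exact bot_le

/-- Doubling of the Green function under multiplication of the level by a constant. -/
lemma exists_green_doubling (hX : Measurable X) (hA : IsPosHalf A) (h : PassesLevels ρ X) :
    ∃ K : ℝ, 2 ≤ K ∧ ∃ z₀ : ℝ, 0 < z₀ ∧ ∀ z, z₀ ≤ z →
      2 * green ρ X A 0 (Iio z) ≤ green ρ X A 0 (Iio (K * z)) := by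
  obtain ⟨p, hp, K, hK, z₀, hz₀, H⟩ := h
  have hp1 : p ≤ 1 := (H z₀ le_rfl).trans prob_le_one
  have hpt : p ≠ ⊤ := ne_top_of_le_ne_top ENNReal.one_ne_top hp1
  have step : ∀ z, z₀ ≤ z →
      (1 + p) * green ρ X A 0 (Iio z) ≤ green ρ X A 0 (Iio ((K + 1) * z)) := by
    intro z hz
    have hle : z ≤ (K + 1) * z := by nlinarith
    have hd : Disjoint (Iio z) (Ico z ((K + 1) * z)) :=
      Set.disjoint_left.2 fun w h1 h2 => absurd (mem_Iio.1 h1) (not_lt.2 h2.1)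
    rw [← Iio_union_Ico_eq_Iio hle, green_union ρ hX hA 0 measurableSet_Ico hd, add_mul, one_mul,
      mul_comm p]
    gcongr
    exact le_trans (by gcongr; exact H z hz) (green_window_ge ρ hX hA)
  have iter : ∀ n : ℕ, ∀ z, z₀ ≤ z →
      (1 + p) ^ n * green ρ X A 0 (Iio z) ≤ green ρ X A 0 (Iio ((K + 1) ^ n * z)) := by
    intro n
    induction n with
    | zero => intro z _; simp
    | succ n ih =>
      intro z hz
      have h1 : z₀ ≤ (K + 1) ^ n * z := by
        have : (1 : ℝ) ≤ (K + 1) ^ n := one_le_pow₀ (by linarith)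
        nlinarith
      calc (1 + p) ^ (n + 1) * green ρ X A 0 (Iio z)
          = (1 + p) * ((1 + p) ^ n * green ρ X A 0 (Iio z)) := by ring
        _ ≤ (1 + p) * green ρ X A 0 (Iio ((K + 1) ^ n * z)) := by gcongr; exact ih z hz
        _ ≤ green ρ X A 0 (Iio ((K + 1) * ((K + 1) ^ n * z))) := step _ h1
        _ = _ := by ring_nf
  obtain ⟨n, hn⟩ : ∃ n : ℕ, (2 : ENNReal) ≤ (1 + p) ^ n := by
    obtain ⟨n, hn⟩ := pow_unbounded_of_one_lt (2 : ℝ)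
      (show (1 : ℝ) < 1 + p.toReal by linarith [ENNReal.toReal_pos hp.ne' hpt])
    refine ⟨n, ?_⟩
    have : (1 + p) = ENNReal.ofReal (1 + p.toReal) := by
      rw [ENNReal.ofReal_add zero_le_one ENNReal.toReal_nonneg, ENNReal.ofReal_one,
        ENNReal.ofReal_toReal hpt]
    rw [this, ← ENNReal.ofReal_pow (by positivity)]
    exact (ENNReal.le_ofReal_iff_toReal_le (by simp) (by positivity)).2 (by simpa using hn.le)
  refine ⟨(K + 1) ^ (n + 1), ?_, z₀, hz₀, fun z hz => ?_⟩
  · calc (2 : ℝ) ≤ (K + 1) ^ 1 := by linarith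
      _ ≤ (K + 1) ^ (n + 1) := pow_le_pow_right₀ (by linarith) (by omega)
  · calc 2 * green ρ X A 0 (Iio z) ≤ (1 + p) ^ n * green ρ X A 0 (Iio z) := by gcongr
      _ ≤ (1 + p) ^ (n + 1) * green ρ X A 0 (Iio z) := by
        gcongr
        · exact le_self_add
        · omega
      _ ≤ _ := iter (n + 1) z hz

end Growth

/-! ### Passing levels under a limit theorem -/

section Levels

variable {E : Type*} [MeasurableSpace E] (ρ : Measure E) [IsProbabilityMeasure ρ]
variable {X : E → ℝ}

lemma measure_inter_shift (k : ℕ) {F H : Set (ℕ → E)} (hF : MeasurableSet F)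
    (hH : MeasurableSet H) (hs : ∀ x y, splice k x y ∈ F ↔ x ∈ F) :
    seqLaw ρ (F ∩ shiftSeq k ⁻¹' H) = seqLaw ρ F * seqLaw ρ H := by
  rw [measure_splice ρ k (hF.inter (hH.preimage (measurable_shiftSeq k))), mul_comm,
    ← lintegral_indicator_const hF]
  refine lintegral_congr fun x => ?_
  by_cases hx : x ∈ F
  · rw [Set.indicator_of_mem hx]
    congr 1
    ext y
    simp [hs, hx]
  · rw [Set.indicator_of_notMem hx]
    convert measure_empty (μ := seqLaw ρ)
    ext y
    simp [hs, hx]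

lemma exists_measure_ge_lt {S : Type*} [MeasurableSpace S] (m : Measure S) [IsFiniteMeasure m]
    {f : S → ℝ} (hf : Measurable f) {ε : ENNReal} (hε : 0 < ε) :
    ∃ R : ℝ, 0 < R ∧ ∀ r, R ≤ r → m {s | r ≤ f s} < ε := by
  have h := tendsto_measure_iInter_atTop (μ := m) (s := fun n : ℕ => {s | (n : ℝ) ≤ f s})
    (fun n => (measurableSet_le measurable_const hf).nullMeasurableSet)
    (fun i j hij s (hs : (j : ℝ) ≤ f s) => show (i : ℝ) ≤ f s from
      le_trans (by exact_mod_cast hij) hs) ⟨0, measure_ne_top _ _⟩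
  have he : ⋂ n : ℕ, {s | (n : ℝ) ≤ f s} = ∅ := by
    ext s
    simp only [mem_iInter, Set.mem_ofPred_eq, mem_empty_iff_false, iff_false, not_forall, not_le]
    exact exists_nat_gt (f s)
  rw [he, measure_empty] at h
  obtain ⟨n, hn⟩ := ((tendsto_order.1 h).2 ε hε).exists
  refine ⟨n + 1, by positivity, fun r hr => lt_of_le_of_lt (measure_mono fun s hs => ?_) hn⟩
  have : r ≤ f s := hs
  show (n : ℝ) ≤ f s
  linarith

/-- Ottaviani's inequality. -/
lemma measure_exists_gt_mul_le (hX : Measurable X) {n : ℕ} {a b : ℝ} {q : ENNReal}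
    (hq : ∀ j ≤ n, q ≤ seqLaw ρ {x | -b < pathSum X j x}) :
    seqLaw ρ {x | ∃ i ≤ n, a + b < pathSum X i x} * q ≤ seqLaw ρ {x | a < pathSum X n x} := by
  classical
  set F : ℕ → Set (ℕ → E) := fun k => {x | (∀ i ∈ Finset.range k, pathSum X i x ≤ a + b) ∧
    a + b < pathSum X k x} with hFdef
  have hF : ∀ k, MeasurableSet (F k) := by
    intro k
    have : F k = (⋂ i ∈ Finset.range k, {x | pathSum X i x ≤ a + b}) ∩
        {x | a + b < pathSum X k x} := by
      ext x; simp [hFdef]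
    rw [this]
    refine (Finset.measurableSet_biInter _ fun i _ => ?_).inter ?_
    · exact measurableSet_le (measurable_pathSum hX i) measurable_const
    · exact measurableSet_lt measurable_const (measurable_pathSum hX k)
  have hFs : ∀ k x y, splice k x y ∈ F k ↔ x ∈ F k := fun k x y => by
    simp only [hFdef, Set.mem_ofPred_eq, pathSum_splice_of_le X le_rfl]
    refine and_congr_left fun _ => forall₂_congr fun i hi => ?_
    rw [pathSum_splice_of_le X (Finset.mem_range.1 hi).le]
  have hH : ∀ j, MeasurableSet {x : ℕ → E | -b < pathSum X j x} := fun j =>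
    measurableSet_lt measurable_const (measurable_pathSum hX j)
  have hdisj : ∀ k k', k < k' → Disjoint (F k) (F k') := fun k k' h =>
    Set.disjoint_left.2 fun x h1 h2 =>
      absurd (h2.1 k (Finset.mem_range.2 h)) (not_le.2 h1.2)
  have hdisj' : ∀ k k', k ≠ k' → Disjoint (F k) (F k') := fun k k' h => by
    rcases lt_or_gt_of_ne h with h | h
    · exact hdisj _ _ h
    · exact (hdisj _ _ h).symm
  set T : ℕ → Set (ℕ → E) := fun k => F k ∩ shiftSeq k ⁻¹' {x | -b < pathSum X (n - k) x}
    with hTdef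
  calc seqLaw ρ {x | ∃ i ≤ n, a + b < pathSum X i x} * q
      ≤ (∑ k ∈ Finset.range (n + 1), seqLaw ρ (F k)) * q := by
        gcongr
        refine le_trans (measure_mono ?_) (measure_biUnion_finset_le _ _)
        rintro x ⟨i, hi, hx⟩
        have hex : ∃ i, a + b < pathSum X i x := ⟨i, hx⟩
        have h2 := Nat.find_min' hex hx
        simp only [Set.mem_iUnion]
        exact ⟨Nat.find hex, Finset.mem_range.2 (by omega),
          fun j hj => not_lt.1 (Nat.find_min hex (Finset.mem_range.1 hj)), Nat.find_spec hex⟩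
    _ = ∑ k ∈ Finset.range (n + 1), seqLaw ρ (F k) * q := Finset.sum_mul _ _ _
    _ ≤ ∑ k ∈ Finset.range (n + 1), seqLaw ρ (T k) := by
        refine Finset.sum_le_sum fun k hk => ?_
        rw [hTdef, measure_inter_shift ρ k (hF k) (hH _) (hFs k)]
        gcongr
        exact hq _ (by omega)
    _ = seqLaw ρ (⋃ k ∈ Finset.range (n + 1), T k) := by
        rw [measure_biUnion_finset]
        · exact fun k _ k' _ h => (hdisj' k k' h).mono inter_subset_left inter_subset_left
        · exact fun k _ => (hF k).inter ((hH _).preimage (measurable_shiftSeq k))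
    _ ≤ seqLaw ρ {x | a < pathSum X n x} := by
        refine measure_mono fun x hx => ?_
        simp only [Set.mem_iUnion, Finset.mem_range] at hx
        obtain ⟨k, hk, h1, h2⟩ := hx
        have h3 : -b < pathSum X (n - k) (shiftSeq k x) := h2
        rw [pathSum_shiftSeq, show k + (n - k) = n by omega] at h3
        have h4 : a + b < pathSum X k x := h1.2
        show a < pathSum X n x
        linarith

lemma WeakTendsto.eventually_lt_of_isOpen {μs : ℕ → Measure ℝ} {ν : Measure ℝ}
    [hμs : ∀ n, IsProbabilityMeasure (μs n)] [hν : IsProbabilityMeasure ν]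
    (h : WeakTendsto μs ν) {G : Set ℝ} (hG : IsOpen G) {a : ENNReal} (ha : a < ν G) :
    ∀ᶠ n in atTop, a < μs n G := by
  have h' : Tendsto (β := ProbabilityMeasure ℝ) (fun n => ⟨μs n, hμs n⟩) atTop
      (𝓝 ⟨ν, hν⟩) :=
    ProbabilityMeasure.tendsto_iff_forall_integral_tendsto.2 h
  exact eventually_lt_of_lt_liminf
    (lt_of_lt_of_le ha (ProbabilityMeasure.le_liminf_measure_open_of_tendsto h' hG))

lemma WeakTendsto.eventually_lt_of_isClosed {μs : ℕ → Measure ℝ} {ν : Measure ℝ}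
    [hμs : ∀ n, IsProbabilityMeasure (μs n)] [hν : IsProbabilityMeasure ν]
    (h : WeakTendsto μs ν) {G : Set ℝ} (hG : IsClosed G) {a : ENNReal} (ha : ν G < a) :
    ∀ᶠ n in atTop, μs n G < a := by
  have h' : Tendsto (β := ProbabilityMeasure ℝ) (fun n => ⟨μs n, hμs n⟩) atTop
      (𝓝 ⟨ν, hν⟩) :=
    ProbabilityMeasure.tendsto_iff_forall_integral_tendsto.2 h
  exact eventually_lt_of_limsup_lt
    (lt_of_le_of_lt (ProbabilityMeasure.limsup_measure_closed_le_of_tendsto h' hG) ha)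

lemma exists_pos_measure_Ioi {ν : Measure ℝ} (h : 0 < ν (Ioi 0)) :
    ∃ δ : ℝ, 0 < δ ∧ 0 < ν (Ioi δ) := by
  by_contra! hcon
  refine h.ne' ?_
  have : Ioi (0 : ℝ) = ⋃ n : ℕ, Ioi (1 / ((n : ℝ) + 1)) := by
    ext e
    simp only [Set.mem_iUnion, mem_Ioi]
    exact ⟨fun he => exists_nat_one_div_lt he, fun ⟨n, hn⟩ => lt_trans (by positivity) hn⟩
  rw [this, measure_iUnion_null_iff]
  exact fun n => nonpos_iff_eq_zero.1 (hcon _ (by positivity))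

/-- The walk passes levels under a limit theorem with a limit that charges the positive
half-line. -/
lemma passesLevels_of_weakTendsto (hX : Measurable X) {c : ℕ → ℝ} (hc : Tendsto c atTop atTop)
    {ν : Measure ℝ} [IsProbabilityMeasure ν] (hν : 0 < ν (Ioi 0))
    (h : WeakTendsto (fun n => (seqLaw ρ).map fun x => pathSum X n x / c n) ν) :
    PassesLevels ρ X := by
  have hmeas : ∀ n, Measurable fun x => pathSum X n x / c n := fun n =>
    (measurable_pathSum hX n).div_const _
  have : ∀ n, IsProbabilityMeasure ((seqLaw ρ).map fun x => pathSum X n x / c n) := fun n =>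
    Measure.isProbabilityMeasure_map (hmeas n).aemeasurable
  obtain ⟨δ, hδ, hδν⟩ := exists_pos_measure_Ioi hν
  obtain ⟨p, hp, hpν⟩ := exists_between hδν
  have hp1 : p < 1 := hpν.trans_le prob_le_one
  have hcpos : ∀ᶠ n in atTop, 0 < c n := hc.eventually_gt_atTop 0
  have hup : ∀ᶠ n in atTop, 0 < c n ∧ p < seqLaw ρ {x | δ * c n < pathSum X n x} := by
    filter_upwards [h.eventually_lt_of_isOpen isOpen_Ioi hpν, hcpos] with n h1 h2
    refine ⟨h2, ?_⟩
    rw [Measure.map_apply (hmeas n) measurableSet_Ioi] at h1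
    convert h1 using 2
    ext x
    simp only [Set.mem_ofPred_eq, mem_preimage, mem_Ioi, lt_div_iff₀ h2]
  obtain ⟨n₀, hn₀⟩ := eventually_atTop.1 hup
  set q : ENNReal := min p (1 / 2) with hq
  have hq0 : 0 < q := lt_min hp (by simp)
  have hqt : q ≠ ⊤ := ne_top_of_le_ne_top hp1.ne_top (min_le_left _ _)
  have hlow : ∀ᶠ n in atTop, ∀ j ≤ n, q ≤ seqLaw ρ {x | -c n < pathSum X j x} := by
    have hsmall : ∀ᶠ n in atTop, ∀ j ∈ Finset.range n₀,
        q ≤ seqLaw ρ {x | -c n < pathSum X j x} := by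
      rw [Filter.eventually_all_finset]
      intro j _
      obtain ⟨R, _, hR⟩ := exists_measure_ge_lt (seqLaw ρ) (measurable_pathSum hX j).neg
        (ε := 1 / 2) (by simp)
      filter_upwards [hc.eventually_ge_atTop R] with n hn
      have h1 := hR _ hn
      have hms : MeasurableSet {x : ℕ → E | c n ≤ -pathSum X j x} :=
        measurableSet_le measurable_const (measurable_pathSum hX j).neg
      have h2 := prob_compl_eq_one_sub (μ := seqLaw ρ) hms
      have h3 : {x : ℕ → E | c n ≤ -pathSum X j x}ᶜ = {x | -c n < pathSum X j x} := by
        ext x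
        simp only [mem_compl_iff, Set.mem_ofPred_eq, not_le]
        constructor <;> intro h <;> linarith
      rw [h3] at h2
      rw [h2]
      refine (min_le_right _ _).trans ?_
      calc (1 / 2 : ENNReal) = 1 - 1 / 2 := by simp
        _ ≤ _ := tsub_le_tsub_left h1.le _
    filter_upwards [hsmall, hcpos] with n h1 h2 j hj
    rcases lt_or_ge j n₀ with h3 | h3
    · exact h1 j (Finset.mem_range.2 h3)
    · have h4 := hn₀ j h3
      refine (min_le_left _ _).trans (h4.2.le.trans (measure_mono fun x hx => ?_))
      have h5 : δ * c j < pathSum X j x := hx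
      have h6 := mul_pos hδ h4.1
      show -c n < pathSum X j x
      linarith
  set ε : ENNReal := p * q / 2 with hε
  have hε0 : 0 < ε := ENNReal.div_pos (mul_ne_zero hp.ne' hq0.ne') (by simp)
  obtain ⟨R, hR0, hR⟩ := exists_measure_ge_lt ν (measurable_id (α := ℝ)) hε0
  have htight : ∀ᶠ n in atTop, seqLaw ρ {x | R * c n ≤ pathSum X n x} < ε := by
    filter_upwards [h.eventually_lt_of_isClosed (isClosed_Ici (a := R)) (hR R le_rfl), hcpos]
      with n h1 h2
    rw [Measure.map_apply (hmeas n) measurableSet_Ici] at h1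
    convert h1 using 2
    ext x
    simp only [Set.mem_ofPred_eq, mem_preimage, mem_Ici, le_div_iff₀ h2]
  have hεp : ε ≤ p / 2 := by
    rw [hε]
    gcongr
    exact mul_le_of_le_one_right' ((min_le_right _ _).trans (by simp))
  have hmain : ∀ᶠ n in atTop, p / 2 ≤ seqLaw ρ
      {x | δ * c n ≤ pathSum X n x ∧ ∀ i ≤ n, pathSum X i x ≤ (R + 1) * c n} := by
    filter_upwards [hup, hlow, htight] with n h1 h2 h3
    have h4 := measure_exists_gt_mul_le ρ hX (a := R * c n) (b := c n) h2
    have h5 : seqLaw ρ {x | ∃ i ≤ n, R * c n + c n < pathSum X i x} ≤ p / 2 := by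
      have h6 := h4.trans ((measure_mono (t := {x | R * c n ≤ pathSum X n x})
        fun x (hx : R * c n < pathSum X n x) => hx.le).trans h3.le)
      rw [hε, ENNReal.mul_div_right_comm] at h6
      exact (ENNReal.mul_le_mul_iff_left hq0.ne' hqt).1 h6
    have h7 : seqLaw ρ {x | δ * c n < pathSum X n x} ≤ seqLaw ρ
        {x | δ * c n ≤ pathSum X n x ∧ ∀ i ≤ n, pathSum X i x ≤ (R + 1) * c n} +
        seqLaw ρ {x | ∃ i ≤ n, R * c n + c n < pathSum X i x} := by
      refine le_trans (measure_mono fun x hx => ?_) (measure_union_le _ _)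
      by_cases hex : ∃ i ≤ n, R * c n + c n < pathSum X i x
      · exact Or.inr hex
      · push Not at hex
        exact Or.inl ⟨le_of_lt hx, fun i hi => (hex i hi).trans (by linarith)⟩
    have h8 := h1.2.le.trans (h7.trans (add_le_add le_rfl h5))
    nth_rewrite 1 [← ENNReal.add_halves p] at h8
    exact (ENNReal.add_le_add_iff_right (ENNReal.div_ne_top hp1.ne_top (by simp))).1 h8
  have hratio : ∀ᶠ n in atTop, δ * c (n + 1) ≤ (R + 1) * c n := by
    obtain ⟨R', _, hR'⟩ := exists_measure_ge_lt ρ hX (ε := p / 2) (ENNReal.half_pos hp.ne')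
    filter_upwards [(tendsto_add_atTop_nat 1).eventually hup, htight, hc.eventually_ge_atTop R']
      with n h1 h2 h3
    by_contra! hcon
    have h4 : seqLaw ρ {x | δ * c (n + 1) < pathSum X (n + 1) x} ≤
        seqLaw ρ {x | R * c n ≤ pathSum X n x} + seqLaw ρ {x | c n ≤ X (x n)} := by
      refine le_trans (measure_mono fun x hx => ?_) (measure_union_le _ _)
      have h5 : δ * c (n + 1) < pathSum X (n + 1) x := hx
      rw [pathSum_succ] at h5
      rcases le_or_gt (c n) (X (x n)) with h6 | h6
      · exact Or.inr h6
      · left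
        show R * c n ≤ pathSum X n x
        linarith
    have h5 : seqLaw ρ {x | c n ≤ X (x n)} = ρ {e | c n ≤ X e} := by
      conv_rhs => rw [← map_eval_seqLaw ρ n]
      rw [Measure.map_apply (measurable_pi_apply n) (measurableSet_le measurable_const hX)]
      rfl
    rw [h5] at h4
    have h6 := h1.2.trans_le (h4.trans (add_le_add (h2.le.trans hεp) (hR' _ h3).le))
    rw [ENNReal.add_halves] at h6
    exact lt_irrefl _ h6
  obtain ⟨n₁, hn₁⟩ := eventually_atTop.1 (hmain.and (hratio.and hcpos))
  set K := max 1 ((R + 1) ^ 2 / δ ^ 2) with hK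
  refine ⟨p / 2, ENNReal.half_pos hp.ne', K, le_max_left _ _, δ * c n₁ + 1, ?_, fun z hz => ?_⟩
  · have := mul_pos hδ (hn₁ n₁ le_rfl).2.2
    positivity
  · classical
    have hex : ∃ n, n₁ ≤ n ∧ z ≤ δ * c n := by
      obtain ⟨n, h1, h2⟩ := ((eventually_ge_atTop n₁).and
        (hc.eventually_ge_atTop (z / δ))).exists
      exact ⟨n, h1, by rwa [div_le_iff₀ hδ, mul_comm] at h2⟩
    obtain ⟨hn1, hn2⟩ := Nat.find_spec hex
    set n := Nat.find hex with hn
    have hne : n ≠ n₁ := by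
      intro h
      rw [h] at hn2
      linarith
    obtain ⟨m, hm⟩ : ∃ m, n = m + 1 := ⟨n - 1, by omega⟩
    have hmn : n₁ ≤ m := by omega
    have hm2 : δ * c m < z := by
      have := Nat.find_min hex (m := m) (by omega)
      push Not at this
      exact this hmn
    have hcm := (hn₁ m hmn).2.1
    rw [← hm] at hcm
    have hKz : (R + 1) * c n ≤ K * z := by
      have h1 : δ ^ 2 * c n ≤ (R + 1) * z := by nlinarith
      have h2 : (R + 1) * c n ≤ (R + 1) ^ 2 / δ ^ 2 * z := by
        rw [div_mul_eq_mul_div, le_div_iff₀ (by positivity)]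
        nlinarith
      refine h2.trans ?_
      have hz0 : 0 ≤ z := by
        have := mul_pos hδ (hn₁ n₁ le_rfl).2.2
        linarith
      gcongr
      exact le_max_right _ _
    refine (hn₁ n hn1).1.trans (measure_mono fun x hx => ?_)
    exact ⟨n, hn2.trans hx.1, fun i hi => (hx.2 i hi).trans hKz⟩

end Levels

/-! ### The renewal function of the dual ladder heights -/

section StayBelow

variable {E : Type*}

/-- The walk stays in `A` and below `z` up to time `n`. -/
def stayBelow (X : E → ℝ) (A : Set ℝ) (z : ℝ) (n : ℕ) : Set (ℕ → E) :=
  {x | ∀ i ∈ Finset.Icc 1 n, pathSum X i x ∈ A ∧ pathSum X i x ≤ z}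

lemma stayBelow_splice {X : E → ℝ} {A : Set ℝ} (z : ℝ) {n k : ℕ} (h : n ≤ k) (x y : ℕ → E) :
    splice k x y ∈ stayBelow X A z n ↔ x ∈ stayBelow X A z n := by
  refine forall₂_congr fun i hi => ?_
  rw [pathSum_splice_of_le X ((Finset.mem_Icc.1 hi).2.trans h)]

lemma nonneg_of_mem_stayBelow {X : E → ℝ} {A : Set ℝ} (hA : IsPosHalf A) {z : ℝ} {n : ℕ} {x : ℕ → E}
    (h : x ∈ stayBelow X A z n) : 0 ≤ pathSum X n x := by
  rcases Nat.eq_zero_or_pos n with rfl | hn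
  · simp
  · exact hA.nonneg (h n (Finset.mem_Icc.2 ⟨hn, le_rfl⟩)).1

end StayBelow

section Renewal

variable {E : Type*} [MeasurableSpace E] (ρ : Measure E) [IsProbabilityMeasure ρ]

/-- The renewal function that is harmonic for the walk killed outside `A`. -/
def renewal (X : E → ℝ) (A : Set ℝ) (a : ℝ) : ENNReal :=
  1 + ∑' k : ℕ, seqLaw ρ {x | a + pathSum X (k + 1) x ∈ A ∧
    ∀ i ∈ Finset.Icc 1 (k + 1), pathSum X i x ∉ A}

/-- The renewal function is superharmonic for the walk killed outside `A`. -/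
def RenewalSuperharmonic (X : E → ℝ) (A : Set ℝ) : Prop :=
  ∀ a, 0 ≤ a → ∫⁻ e in {e | a + X e ∈ A}, renewal ρ X A (a + X e) ∂ρ ≤ renewal ρ X A a

variable {X : E → ℝ} {A : Set ℝ}

lemma one_le_renewal (a : ℝ) : 1 ≤ renewal ρ X A a := le_self_add

lemma renewal_mono (hA : IsPosHalf A) : Monotone (renewal ρ X A) := by
  intro a b hab
  refine add_le_add le_rfl (ENNReal.tsum_le_tsum fun k => measure_mono ?_)
  rintro x ⟨h1, h2⟩
  refine ⟨?_, h2⟩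
  have := hA.add_mem h1 (sub_nonneg.2 hab)
  rwa [show a + pathSum X (k + 1) x + (b - a) = b + pathSum X (k + 1) x by ring] at this

lemma measurable_renewal (hA : IsPosHalf A) : Measurable (renewal ρ X A) :=
  (renewal_mono ρ hA).measurable

lemma renewal_zero : renewal ρ X A 0 = 1 := by
  unfold renewal
  convert add_zero _
  rw [ENNReal.tsum_eq_zero]
  intro k
  convert measure_empty (μ := seqLaw ρ)
  ext x
  simp only [Set.mem_ofPred_eq, mem_empty_iff_false, iff_false, not_and]
  intro h1 h2
  exact h2 (k + 1) (by simp) (by simpa using h1)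

lemma green_dual_eq (B : Set ℝ) :
    green ρ (fun e => -X e) (dualHalf A) 0 B =
      seqLaw ρ {_x : ℕ → E | (0 : ℝ) ∈ B} +
      ∑' k : ℕ, seqLaw ρ {x | -pathSum X (k + 1) x ∈ B ∧
        ∀ i ∈ Finset.Icc 1 (k + 1), pathSum X i x ∉ A} := by
  unfold green
  rw [tsum_eq_zero_add' ENNReal.summable]
  congr 1
  · simp [stay]
  · refine tsum_congr fun k => ?_
    congr 1
    ext x
    simp only [stay, Set.mem_ofPred_eq, pathSum_neg, zero_add, mem_dualHalf, neg_neg]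
    tauto

lemma renewal_le_green {a : ℝ} (ha : 0 ≤ a) (hA : IsPosHalf A) :
    renewal ρ X A a ≤ green ρ (fun e => -X e) (dualHalf A) 0 (Iic a) := by
  rw [green_dual_eq ρ, renewal]
  refine add_le_add ?_ (ENNReal.tsum_le_tsum fun k => measure_mono ?_)
  · simp [ha]
  · rintro x ⟨h1, h2⟩
    exact ⟨by have := hA.nonneg h1; rw [mem_Iic]; linarith, h2⟩

lemma green_le_renewal (a : ℝ) (hA : IsPosHalf A) :
    green ρ (fun e => -X e) (dualHalf A) 0 (Iio a) ≤ renewal ρ X A a := by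
  rw [green_dual_eq ρ, renewal]
  refine add_le_add prob_le_one (ENNReal.tsum_le_tsum fun k => measure_mono ?_)
  · rintro x ⟨h1, h2⟩
    exact ⟨hA.mem_of_pos (by rw [mem_Iio] at h1; linarith), h2⟩

lemma renewal_le_green_Iio {a b : ℝ} (ha : 0 ≤ a) (hab : a < b) (hA : IsPosHalf A) :
    renewal ρ X A a ≤ green ρ (fun e => -X e) (dualHalf A) 0 (Iio b) :=
  (renewal_le_green ρ ha hA).trans (green_mono ρ 0 (Iic_subset_Iio.2 hab))

lemma renewal_add_le (hX : Measurable X) (hA : IsPosHalf A) {y w : ℝ} (hy : 0 ≤ y) (hw : 0 ≤ w) :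
    renewal ρ X A (y + w) ≤ (1 + green ρ (fun e => -X e) (dualHalf A) 0 (Iio 1)) *
      (renewal ρ X A y + renewal ρ X A w) := by
  have hXn : Measurable fun e => -X e := hX.neg
  set g := green ρ (fun e => -X e) (dualHalf A) 0 (Iio 1)
  calc renewal ρ X A (y + w)
      ≤ green ρ (fun e => -X e) (dualHalf A) 0 (Iio (y + w + 1)) :=
        renewal_le_green_Iio ρ (by positivity) (by linarith) hA
    _ ≤ green ρ (fun e => -X e) (dualHalf A) 0 (Iio y) +
        green ρ (fun e => -X e) (dualHalf A) 0 (Iio w) + g :=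
        (green_Iio_add_le ρ hXn hA.dualHalf _ _).trans
          (add_le_add (green_Iio_add_le ρ hXn hA.dualHalf _ _) le_rfl)
    _ ≤ (renewal ρ X A y + renewal ρ X A w) + g * (renewal ρ X A y + renewal ρ X A w) := by
        gcongr
        · exact green_le_renewal ρ y hA
        · exact green_le_renewal ρ w hA
        · exact le_mul_of_one_le_right' ((one_le_renewal ρ y).trans le_self_add)
    _ = _ := by ring

lemma exists_renewal_le (hX : Measurable X) (hA : IsPosHalf A) (hneg : 0 < ρ {e | X e < 0}) :
    ∃ C : ℝ, 0 < C ∧ ∀ t : ℝ, 0 ≤ t → renewal ρ X A t ≤ ENNReal.ofReal (C * (1 + t)) := by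
  obtain ⟨C, hC, h⟩ := exists_green_Iio_le ρ (X := fun e => -X e) hX.neg hA.dualHalf
    (by simpa using hneg)
  refine ⟨2 * C, by positivity, fun t ht => ?_⟩
  refine (renewal_le_green_Iio ρ ht (lt_add_one t) hA).trans
    ((h _ (by positivity)).trans (ENNReal.ofReal_le_ofReal ?_))
  nlinarith

lemma setLIntegral_step (hX : Measurable X) (n : ℕ) {F : Set (ℕ → E)} (hF : MeasurableSet F)
    (hs : ∀ x y, splice n x y ∈ F ↔ x ∈ F) {h : ℝ → E → ENNReal}
    (hh : Measurable (Function.uncurry h)) :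
    ∫⁻ x in F, h (pathSum X n x) (x n) ∂seqLaw ρ =
      ∫⁻ x in F, ∫⁻ e, h (pathSum X n x) e ∂ρ ∂seqLaw ρ := by
  have hm : Measurable fun x : ℕ → E => h (pathSum X n x) (x n) :=
    hh.comp ((measurable_pathSum hX n).prodMk (measurable_pi_apply n))
  rw [← lintegral_indicator hF, ← lintegral_indicator hF,
    lintegral_splice ρ n (hm.indicator hF)]
  refine lintegral_congr fun x => ?_
  by_cases hx : x ∈ F
  · rw [Set.indicator_of_mem hx]
    have hh' : Measurable fun e => h (pathSum X n x) e := 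
      hh.comp measurable_prodMk_left
    conv_rhs => rw [← map_eval_seqLaw ρ 0, lintegral_map hh' (measurable_pi_apply 0)]
    refine lintegral_congr fun y => ?_
    rw [Set.indicator_of_mem ((hs x y).2 hx), pathSum_splice_of_le X le_rfl]
    simp [splice]
  · rw [Set.indicator_of_notMem hx, ← lintegral_zero (μ := seqLaw ρ)]
    refine lintegral_congr fun y => ?_
    rw [Set.indicator_of_notMem (by rwa [hs])]

lemma measurableSet_stayBelow (hX : Measurable X) (hA : IsPosHalf A) (z : ℝ) (n : ℕ) :
    MeasurableSet (stayBelow X A z n) := by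
  have : stayBelow X A z n = ⋂ j ∈ Finset.Icc 1 n, {x | pathSum X j x ∈ A ∩ Iic z} := by
    ext x; simp [stayBelow]
  rw [this]
  refine Finset.measurableSet_biInter _ fun j _ => ?_
  exact (hA.measurableSet.inter measurableSet_Iic).preimage (measurable_pathSum hX j)

/-- The renewal mass collected on the first jump above `z` is at most one. -/
lemma tsum_lintegral_exit_le_one (hX : Measurable X) (hA : IsPosHalf A)
    (hu : RenewalSuperharmonic ρ X A) {z : ℝ} (hz : 0 ≤ z) :
    ∑' n, ∫⁻ x in stayBelow X A z n, ∫⁻ e in {e | z < pathSum X n x + X e},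
      renewal ρ X A (pathSum X n x + X e) ∂ρ ∂seqLaw ρ ≤ 1 := by
  set u := renewal ρ X A with hudef
  have hum : Measurable u := measurable_renewal ρ hA
  set G := stayBelow X A z with hG
  have hGm : ∀ n, MeasurableSet (G n) := measurableSet_stayBelow hX hA z
  set r : ℕ → ENNReal := fun n => ∫⁻ x in G n, u (pathSum X n x) ∂seqLaw ρ with hr
  set d : ℕ → ENNReal := fun n => ∫⁻ x in G n, ∫⁻ e in {e | z < pathSum X n x + X e},
      u (pathSum X n x + X e) ∂ρ ∂seqLaw ρ with hd
  have hstep : ∀ n, r (n + 1) + d n ≤ r n := by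
    intro n
    have hB : MeasurableSet (A ∩ Iic z) := hA.measurableSet.inter measurableSet_Iic
    have h1 : r (n + 1) = ∫⁻ x in G n, ∫⁻ e,
        ({e | pathSum X n x + X e ∈ A ∩ Iic z}).indicator
          (fun e => u (pathSum X n x + X e)) e ∂ρ ∂seqLaw ρ := by
      have hm : Measurable (Function.uncurry fun (s : ℝ) (e : E) =>
          (A ∩ Iic z).indicator u (s + X e)) := by
        exact (hum.indicator hB).comp (measurable_fst.add (hX.comp measurable_snd))
      have h2 := setLIntegral_step ρ hX n (hGm n) (stayBelow_splice (X := X) (A := A) z le_rfl) hm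
      refine Eq.trans ?_ h2
      rw [hr]
      simp only
      rw [← lintegral_indicator (hGm _), ← lintegral_indicator (hGm _)]
      refine lintegral_congr fun x => ?_
      have h3 : x ∈ G (n + 1) ↔ x ∈ G n ∧ pathSum X n x + X (x n) ∈ A ∩ Iic z := by
        rw [← pathSum_succ]
        constructor
        · intro h
          refine ⟨fun i hi => h i (Finset.mem_Icc.2 ?_), h (n + 1) (by simp)⟩
          have := Finset.mem_Icc.1 hi
          omega
        · rintro ⟨h, h'⟩ i hi
          have := Finset.mem_Icc.1 hi
          rcases Nat.lt_or_eq_of_le this.2 with h4 | rfl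
          · exact h i (Finset.mem_Icc.2 ⟨this.1, by omega⟩)
          · exact h'
      by_cases hx : x ∈ G n
      · by_cases hx' : pathSum X n x + X (x n) ∈ A ∩ Iic z
        · rw [Set.indicator_of_mem (h3.2 ⟨hx, hx'⟩), Set.indicator_of_mem hx,
            Set.indicator_of_mem hx', pathSum_succ]
        · rw [Set.indicator_of_notMem (fun h => hx' (h3.1 h).2), Set.indicator_of_mem hx,
            Set.indicator_of_notMem hx']
      · rw [Set.indicator_of_notMem (fun h => hx (h3.1 h).1), Set.indicator_of_notMem hx]
    rw [h1]
    rw [hd, hr]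
    simp only
    rw [← lintegral_add_left']
    · refine setLIntegral_mono' (hGm n) fun x hx => ?_
      have hms : MeasurableSet {e | pathSum X n x + X e ∈ A ∩ Iic z} :=
        hB.preimage (hX.const_add _)
      rw [lintegral_indicator hms]
      have hms' : MeasurableSet {e | z < pathSum X n x + X e} :=
        measurableSet_lt measurable_const (hX.const_add _)
      rw [← lintegral_union hms']
      · refine le_trans (lintegral_mono_set fun e he => ?_) (hu _ (nonneg_of_mem_stayBelow hA hx))
        rcases he with he | he
        · exact he.1
        · have he : z < pathSum X n x + X e := he
          exact hA.mem_of_pos (by linarith)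
      · refine Set.disjoint_left.2 fun e h1 h2 => ?_
        exact absurd (mem_Iic.1 h1.2) (not_le.2 h2)
    · refine (Measurable.lintegral_prod_right' (f := fun p : (ℕ → E) × E =>
        (A ∩ Iic z).indicator u (pathSum X n p.1 + X p.2)) ?_).aemeasurable
      exact (hum.indicator hB).comp
        (((measurable_pathSum hX n).comp measurable_fst).add (hX.comp measurable_snd))
  have hpart : ∀ N, ∑ n ∈ Finset.range N, d n + r N ≤ 1 := by
    intro N
    induction N with
    | zero =>
      simp only [Finset.range_zero, Finset.sum_empty, zero_add, hr, pathSum_zero]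
      rw [hudef, renewal_zero]
      simpa using prob_le_one
    | succ N ih =>
      rw [Finset.sum_range_succ, add_assoc, add_comm (d N)]
      exact le_trans (by gcongr; exact hstep N) ih
  rw [ENNReal.tsum_eq_iSup_nat]
  exact iSup_le fun N => le_self_add.trans (hpart N)

end Renewal

/-! ### Moments of the renewal function at the increments -/

section Moments

variable {E : Type*} [MeasurableSpace E] (ρ : Measure E) [IsProbabilityMeasure ρ]
variable {X : E → ℝ} {A : Set ℝ}

lemma tsum_stayBelow_mul_le_one (hX : Measurable X) (hA : IsPosHalf A)
    (hu : RenewalSuperharmonic ρ X A) {z : ℝ} (hz : 0 ≤ z) :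
    (∑' n, seqLaw ρ (stayBelow X A z n)) *
      ∫⁻ e in {e | z < X e}, renewal ρ X A (X e) ∂ρ ≤ 1 := by
  refine le_trans ?_ (tsum_lintegral_exit_le_one ρ hX hA hu hz)
  rw [← ENNReal.tsum_mul_right]
  refine ENNReal.tsum_le_tsum fun n => ?_
  rw [mul_comm, ← setLIntegral_const]
  refine setLIntegral_mono' (measurableSet_stayBelow hX hA z n) fun x hx => ?_
  have h0 := nonneg_of_mem_stayBelow hA hx
  have hsub : {e | z < X e} ⊆ {e | z < pathSum X n x + X e} := fun e (he : z < X e) => by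
    show z < pathSum X n x + X e
    linarith
  refine le_trans ?_ (lintegral_mono_set hsub)
  exact lintegral_mono fun e => renewal_mono ρ hA (by linarith)

lemma tsum_exit_mul_le_one (hX : Measurable X) (hA : IsPosHalf A)
    (hu : RenewalSuperharmonic ρ X A) {z : ℝ} (hz : 0 ≤ z) :
    (∑' n, seqLaw ρ (stayBelow X A z n ∩ {x | z < pathSum X (n + 1) x})) * renewal ρ X A z ≤ 1 := by
  refine le_trans ?_ (tsum_lintegral_exit_le_one ρ hX hA hu hz)
  rw [← ENNReal.tsum_mul_right]
  refine ENNReal.tsum_le_tsum fun n => ?_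
  have hm : Measurable (Function.uncurry fun (s : ℝ) (e : E) =>
      (Ioi z).indicator (fun _ => (1 : ENNReal)) (s + X e)) :=
    (measurable_const.indicator measurableSet_Ioi).comp
      (measurable_fst.add (hX.comp measurable_snd))
  have hG := measurableSet_stayBelow hX hA z n
  have h1 : seqLaw ρ (stayBelow X A z n ∩ {x | z < pathSum X (n + 1) x}) =
      ∫⁻ x in stayBelow X A z n, ρ {e | z < pathSum X n x + X e} ∂seqLaw ρ := by
    have h2 := setLIntegral_step ρ hX n hG (stayBelow_splice z le_rfl) hm
    have hms : MeasurableSet {x : ℕ → E | z < pathSum X (n + 1) x} :=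
      measurableSet_lt measurable_const (measurable_pathSum hX _)
    rw [Set.inter_comm, ← Measure.restrict_apply hms, ← lintegral_indicator_one hms]
    refine Eq.trans (lintegral_congr fun x => ?_) (h2.trans (lintegral_congr fun x => ?_))
    · simp only [indicator_apply, Set.mem_ofPred_eq, mem_Ioi, pathSum_succ, Pi.one_apply]
    · rw [← lintegral_indicator_one (measurableSet_lt measurable_const (hX.const_add _))]
      refine lintegral_congr fun e => ?_
      simp only [indicator_apply, Set.mem_ofPred_eq, mem_Ioi, Pi.one_apply]
  rw [h1]
  refine (lintegral_mul_const_le _ _).trans (lintegral_mono fun x => ?_)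
  rw [mul_comm, ← setLIntegral_const]
  refine setLIntegral_mono' (measurableSet_lt measurable_const (hX.const_add _)) fun e he => ?_
  exact renewal_mono ρ hA (le_of_lt he)

lemma green_window_le_mul (hX : Measurable X) (hA : IsPosHalf A) {y : ℝ} (hy : 0 ≤ y) {z : ℝ} :
    green ρ X A y (Ico 0 z) ≤ green ρ X A 0 (Iio z) *
      green ρ (fun e => -X e) (dualHalf A) 0 (Iio (z + 1)) := by
  have h := green_le_mul ρ hX hA hy 0 z
  rw [zero_add] at h
  refine h.trans (mul_le_mul' (green_mono ρ 0 fun w hw => hw.2) ?_)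
  have h2 := green_window_le ρ (X := fun e => -X e) hX.neg hA.dualHalf (y - z) (z + 1)
  refine le_trans (green_mono ρ 0 fun w hw => ?_)
    (h2.trans (green_mono ρ 0 fun w hw => hw.2))
  have h3 := hw.1
  have h4 := hw.2
  exact ⟨by linarith, by linarith⟩

/-- The renewal function integrated over the large increments is controlled by the reciprocal of
the Green function. -/
lemma green_mul_lintegral_le (hX : Measurable X) (hA : IsPosHalf A)
    (hpos : 0 < ρ {e | 0 < X e}) (hu : RenewalSuperharmonic ρ X A) {z z' : ℝ} (hz : 0 ≤ z)
    (hz' : 0 ≤ z')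
    (h2 : 2 * green ρ (fun e => -X e) (dualHalf A) 0 (Iio (z' + 1)) ≤ renewal ρ X A z) :
    green ρ X A 0 (Iio z') * ∫⁻ e in {e | z < X e}, renewal ρ X A (X e) ∂ρ ≤ 2 := by
  classical
  set V := green ρ X A 0 (Iio z') with hV
  set V' := green ρ (fun e => -X e) (dualHalf A) 0 (Iio (z' + 1)) with hV'
  have hVtop : V ≠ ⊤ := by
    obtain ⟨C, _, h⟩ := exists_green_Iio_le ρ hX hA hpos
    exact ne_top_of_le_ne_top ENNReal.ofReal_ne_top (h _ hz')
  set F : ℕ → Set (ℕ → E) := fun k => match k with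
    | 0 => ∅
    | k + 1 => stayBelow X A z k ∩ {x | z < pathSum X (k + 1) x} with hF
  have hFm : ∀ k, MeasurableSet (F k) := by
    intro k
    cases k with
    | zero => exact MeasurableSet.empty
    | succ k =>
      have h3 : MeasurableSet {x : ℕ → E | z < pathSum X (k + 1) x} :=
        measurableSet_lt measurable_const (measurable_pathSum hX _)
      exact (measurableSet_stayBelow hX hA z k).inter h3
  have hFs : ∀ k x y, splice k x y ∈ F k ↔ x ∈ F k := by
    intro k x y
    cases k with
    | zero => exact Iff.rfl
    | succ k =>
      refine and_congr (stayBelow_splice z (Nat.le_succ k) x y) ?_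
      simp only [Set.mem_ofPred_eq, pathSum_splice_of_le X le_rfl]
  have hF0 : ∀ k, ∀ x ∈ F k, 0 ≤ pathSum X k x := by
    intro k x hx
    cases k with
    | zero => exact absurd hx (Set.notMem_empty x)
    | succ k => exact hz.trans (le_of_lt hx.2)
  set B := ∑' k, seqLaw ρ (F k) with hB
  have hBu : B * renewal ρ X A z ≤ 1 := by
    have h := tsum_exit_mul_le_one ρ hX hA hu hz
    rw [hB, tsum_eq_zero_add' ENNReal.summable]
    simpa [hF] using h
  set R : ℕ → Set (ℕ → E) := fun n => {x | x ∈ stay X A n 0 ∧ 0 + pathSum X n x ∈ Iio z'}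
    with hR
  set T : ℕ → ℕ → Set (ℕ → E) := fun k m => F k ∩ {x | shiftSeq k x ∈ stay X A m (pathSum X k x) ∧
    pathSum X (k + m) x ∈ Ico 0 z'} with hT
  have hTm : ∀ k m, MeasurableSet (T k m) := by
    intro k m
    refine (hFm k).inter (MeasurableSet.inter ?_ ?_)
    · have : {x | shiftSeq k x ∈ stay X A m (pathSum X k x)} =
          ⋂ j ∈ Finset.Icc 1 m, {x | pathSum X k x + pathSum X j (shiftSeq k x) ∈ A} := by
        ext x; simp [stay]
      have h3 : MeasurableSet {x | shiftSeq k x ∈ stay X A m (pathSum X k x)} := by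
        rw [this]
        refine Finset.measurableSet_biInter _ fun j _ => ?_
        exact hA.measurableSet.preimage ((measurable_pathSum hX k).add
          ((measurable_pathSum hX j).comp (measurable_shiftSeq k)))
      exact h3
    · exact measurableSet_Ico.preimage (measurable_pathSum hX (k + m))
  have hlate : ∑' n, seqLaw ρ (R n \ stayBelow X A z n) ≤ (V * V') * B := by
    refine tsum_measure_le_of_splice ρ hTm hFm ?_ ?_
    · rintro n x ⟨⟨hst, hlt⟩, hnb⟩
      rw [zero_add, mem_Iio] at hlt
      have hst' : ∀ j ∈ Finset.Icc 1 n, pathSum X j x ∈ A := fun j hj => by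
        simpa using hst j hj
      have hex : ∃ i, i ∈ Finset.Icc 1 n ∧ z < pathSum X i x := by
        by_contra! hcon
        exact hnb fun i hi => ⟨hst' i hi, hcon i hi⟩
      obtain ⟨hk, hkz⟩ := Nat.find_spec hex
      have hmin : ∀ i, i < Nat.find hex → i ∈ Finset.Icc 1 n → pathSum X i x ≤ z := fun i hi h =>
        not_lt.1 fun h' => Nat.find_min hex hi ⟨h, h'⟩
      set k := Nat.find hex
      have hk' := Finset.mem_Icc.1 hk
      refine ⟨k, n - k, by omega, ?_, ?_, ?_⟩
      · obtain ⟨l, hl⟩ : ∃ l, k = l + 1 := ⟨k - 1, by omega⟩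
        rw [hl]
        refine ⟨fun i hi => ?_, by rw [hl] at hkz; exact hkz⟩
        have hi' := Finset.mem_Icc.1 hi
        have hin : i ∈ Finset.Icc 1 n := Finset.mem_Icc.2 ⟨hi'.1, by omega⟩
        exact ⟨hst' i hin, hmin i (by omega) hin⟩
      · intro j hj
        have hj' := Finset.mem_Icc.1 hj
        rw [pathSum_shiftSeq, add_sub_cancel]
        exact hst' _ (Finset.mem_Icc.2 ⟨by omega, by omega⟩)
      · rw [show k + (n - k) = n by omega]
        exact ⟨hA.nonneg (hst' n (Finset.mem_Icc.2 ⟨by omega, le_rfl⟩)), hlt⟩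
    · intro k x
      by_cases hx : x ∈ F k
      · rw [Set.indicator_of_mem hx]
        refine le_trans ?_ (green_window_le_mul ρ hX hA (hF0 k x hx))
        refine ENNReal.tsum_le_tsum fun m => measure_mono fun y hy => ?_
        have h2 := hy.2
        simp only [Set.mem_ofPred_eq, shiftSeq_splice, pathSum_splice_of_le X le_rfl,
          pathSum_splice_add] at h2
        exact h2
      · rw [Set.indicator_of_notMem hx, nonpos_iff_eq_zero, ENNReal.tsum_eq_zero]
        intro m
        rw [show {z | splice k x z ∈ T k m} = ∅ from ?_, measure_empty]
        ext z
        simp [hT, hFs, hx]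
  set G := ∑' n, seqLaw ρ (stayBelow X A z n) with hG
  have hsplit : V ≤ G + V * V' * B := by
    refine le_trans ?_ (add_le_add le_rfl hlate)
    rw [hV, hG, green, ← ENNReal.tsum_add]
    refine ENNReal.tsum_le_tsum fun n => le_trans (measure_mono fun x hx => ?_)
      (measure_union_le _ _)
    by_cases h : x ∈ stayBelow X A z n
    · exact Or.inl h
    · exact Or.inr ⟨hx, h⟩
  have hhalf : V * V' * B ≤ V / 2 := by
    rw [mul_assoc, ENNReal.div_eq_inv_mul, mul_comm _ V]
    gcongr
    rw [← one_div, ENNReal.le_div_iff_mul_le (by simp) (by simp)]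
    calc V' * B * 2 = B * (2 * V') := by ring
      _ ≤ B * renewal ρ X A z := by gcongr
      _ ≤ 1 := hBu
  have hVG : V ≤ 2 * G := by
    have h3 : V / 2 + V / 2 ≤ G + V / 2 := by
      rw [ENNReal.add_halves]
      exact hsplit.trans (by gcongr)
    have h4 := (ENNReal.add_le_add_iff_right (ENNReal.div_ne_top hVtop (by simp))).1 h3
    rwa [ENNReal.div_le_iff (by simp) (by simp), mul_comm] at h4
  calc V * ∫⁻ e in {e | z < X e}, renewal ρ X A (X e) ∂ρ
      ≤ 2 * G * ∫⁻ e in {e | z < X e}, renewal ρ X A (X e) ∂ρ := by gcongr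
    _ ≤ 2 * 1 := by
        rw [mul_assoc]
        gcongr
        exact tsum_stayBelow_mul_le_one ρ hX hA hu hz
    _ = 2 := by norm_num

lemma exists_level_const (hX : Measurable X) (hA : IsPosHalf A)
    (hpos : 0 < ρ {e | 0 < X e}) (hu : RenewalSuperharmonic ρ X A) (hP : PassesLevels ρ X)
    (hP' : PassesLevels ρ fun e => -X e) :
    ∃ K : ℝ, 2 ≤ K ∧ ∃ z₀ : ℝ, 0 < z₀ ∧ ∀ z, z₀ ≤ z →
      2 * green ρ X A 0 (Iio z) ≤ green ρ X A 0 (Iio (K * z)) ∧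
      green ρ X A 0 (Iio z) * ∫⁻ e in {e | K * z < X e}, renewal ρ X A (X e) ∂ρ ≤ 2 := by
  obtain ⟨K₁, hK₁, z₁, hz₁, H₁⟩ := exists_green_doubling ρ hX hA hP
  obtain ⟨K₂, hK₂, z₂, hz₂, H₂⟩ :=
    exists_green_doubling ρ (X := fun e => -X e) hX.neg hA.dualHalf hP'
  refine ⟨max K₁ (2 * K₂), hK₁.trans (le_max_left _ _), max z₁ (max z₂ 1),
    lt_max_of_lt_left hz₁, fun z hz => ?_⟩
  have h1 : z₁ ≤ z := (le_max_left _ _).trans hz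
  have h2 : z₂ ≤ z := (le_max_left _ _).trans ((le_max_right _ _).trans hz)
  have h3 : 1 ≤ z := (le_max_right _ _).trans ((le_max_right _ _).trans hz)
  have hz0 : 0 ≤ z := by linarith
  constructor
  · refine (H₁ z h1).trans (green_mono ρ 0 (Iio_subset_Iio ?_))
    gcongr
    exact le_max_left _ _
  · refine green_mul_lintegral_le ρ hX hA hpos hu (by positivity) hz0 ?_
    refine (H₂ (z + 1) (by linarith)).trans ((green_le_renewal ρ _ hA).trans
      (renewal_mono ρ hA ?_))
    calc K₂ * (z + 1) ≤ 2 * K₂ * z := by nlinarith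
      _ ≤ _ := by gcongr; exact le_max_right _ _

lemma lintegral_renewal_posPart_le (hX : Measurable X) (hA : IsPosHalf A)
    (hu : RenewalSuperharmonic ρ X A) :
    ∫⁻ e, renewal ρ X A (max (X e) 0) ∂ρ ≤ 2 := by
  have hm : MeasurableSet {e | X e ∈ A} := hA.measurableSet.preimage hX
  rw [← lintegral_add_compl _ hm]
  have h1 : ∫⁻ e in {e | X e ∈ A}, renewal ρ X A (max (X e) 0) ∂ρ ≤ 1 := by
    have h := hu 0 le_rfl
    simp only [zero_add, renewal_zero] at h
    refine le_trans (setLIntegral_mono' hm fun e he => ?_) h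
    rw [max_eq_left (hA.nonneg he)]
  have h2 : ∫⁻ e in {e | X e ∈ A}ᶜ, renewal ρ X A (max (X e) 0) ∂ρ ≤ 1 := by
    refine le_trans (setLIntegral_mono' hm.compl (g := fun _ => 1) fun e he => ?_) ?_
    · rw [max_eq_right (hA.nonpos_of_notMem he), renewal_zero]
    · rw [setLIntegral_const, one_mul]
      exact prob_le_one
  calc _ ≤ (1 : ENNReal) + 1 := add_le_add h1 h2
    _ = 2 := by norm_num

lemma lintegral_green_mul_renewal_lt_top (hX : Measurable X) (hA : IsPosHalf A)
    (hpos : 0 < ρ {e | 0 < X e}) (hneg : 0 < ρ {e | X e < 0})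
    (hu : RenewalSuperharmonic ρ X A) (hP : PassesLevels ρ X)
    (hP' : PassesLevels ρ fun e => -X e) {l : E → ℝ} (hl : Measurable l)
    (hl1 : ∀ e, 1 ≤ l e) {ε : ℝ} (hε : 0 < ε)
    (hmom : ∫⁻ e, ENNReal.ofReal (l e ^ (2 + ε)) ∂ρ < ⊤) :
    ∫⁻ e, green ρ X A 0 (Iio (l e)) *
      (ENNReal.ofReal (l e) + renewal ρ X A (max (X e) 0)) ∂ρ < ⊤ := by
  classical
  set V : ℝ → ENNReal := fun t => green ρ X A 0 (Iio t) with hV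
  set u := renewal ρ X A with hudef
  have hVmono : Monotone V := fun a b h => green_mono ρ 0 (Iio_subset_Iio h)
  have hum : Measurable u := measurable_renewal ρ hA
  obtain ⟨C, hC, hVC⟩ := exists_green_Iio_le ρ hX hA hpos
  obtain ⟨C', hC', huC⟩ := exists_renewal_le ρ hX hA hneg
  obtain ⟨K, hK, z₀, hz₀, HK⟩ := exists_level_const ρ hX hA hpos hu hP hP'
  have hK1 : 1 ≤ K := by linarith
  have hiter : ∀ m : ℕ, ∀ z, z₀ ≤ z → 2 ^ m * V z ≤ V (K ^ m * z) := by
    intro m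
    induction m with
    | zero => intro z _; simp
    | succ m ih =>
      intro z hz
      have h1 : z₀ ≤ K ^ m * z := by
        have : (1 : ℝ) ≤ K ^ m := one_le_pow₀ hK1
        nlinarith
      calc 2 ^ (m + 1) * V z = 2 * (2 ^ m * V z) := by ring
        _ ≤ 2 * V (K ^ m * z) := by gcongr; exact ih z hz
        _ ≤ V (K * (K ^ m * z)) := (HK _ h1).1
        _ = V (K ^ (m + 1) * z) := by ring_nf
  obtain ⟨N, hN⟩ := exists_nat_ge (1 / ε)
  have hNε : 1 ≤ N * ε := by rwa [div_le_iff₀ hε] at hN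
  have hN0 : N ≠ 0 := by
    rintro rfl
    norm_num at hNε
  obtain ⟨s, hs⟩ := pow_unbounded_of_one_lt z₀ (show 1 < K by linarith)
  set j₀ := N + 1 + s with hj₀
  set J : ℕ → ENNReal := fun i => ∫⁻ e in {e | K ^ ((N + 1) * (j₀ + i)) < X e}, u (X e) ∂ρ with hJ
  have hterm : ∀ i, V (K ^ (N * (j₀ + i + 1))) * J i ≤ 2 * 2⁻¹ ^ i := by
    intro i
    have hz : z₀ ≤ K ^ (N * (j₀ + i + 1)) := by
      refine hs.le.trans (pow_le_pow_right₀ hK1 ?_)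
      have : 1 * (j₀ + i + 1) ≤ N * (j₀ + i + 1) :=
        Nat.mul_le_mul_right _ (Nat.one_le_iff_ne_zero.2 hN0)
      omega
    have h1 := hiter (i + s) _ hz
    have h2 := (HK (K ^ (i + s) * K ^ (N * (j₀ + i + 1))) (by
      have : (1 : ℝ) ≤ K ^ (i + s) := one_le_pow₀ hK1
      nlinarith)).2
    have h3 : K * (K ^ (i + s) * K ^ (N * (j₀ + i + 1))) = K ^ ((N + 1) * (j₀ + i)) := by
      rw [← pow_add, ← pow_succ']
      congr 1
      rw [hj₀]
      ring
    rw [h3] at h2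
    have h4 : 2 ^ i * (V (K ^ (N * (j₀ + i + 1))) * J i) ≤ 2 := by
      refine le_trans ?_ h2
      rw [← mul_assoc]
      refine mul_le_mul' (le_trans ?_ h1) le_rfl
      gcongr
      · norm_num
      · omega
    rw [← ENNReal.inv_pow, ← div_eq_mul_inv, ENNReal.le_div_iff_mul_le (by simp) (by simp),
      mul_comm]
    exact h4
  have hpt : ∀ e, V (l e) * u (max (X e) 0) ≤ V (l e) * u (l e ^ (1 + ε)) +
      (V (K ^ (N * j₀)) * u (max (X e) 0) + ∑' i : ℕ, V (K ^ (N * (j₀ + i + 1))) *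
        ({e | K ^ ((N + 1) * (j₀ + i)) < X e}).indicator (fun e => u (X e)) e) := by
    intro e
    have hle := hl1 e
    rcases le_or_gt (X e) (l e ^ (1 + ε)) with h | h
    · refine le_trans ?_ le_self_add
      gcongr
      exact renewal_mono ρ hA (max_le h (by positivity))
    refine le_trans ?_ le_add_self
    rcases le_or_gt (l e) (K ^ (N * j₀)) with h' | h'
    · refine le_trans ?_ le_self_add
      gcongr
      exact hVmono h'
    refine le_trans ?_ le_add_self
    have hex : ∃ i : ℕ, l e ≤ K ^ (N * (j₀ + i + 1)) := by
      obtain ⟨i, hi⟩ := pow_unbounded_of_one_lt (l e) (show 1 < K by linarith)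
      refine ⟨i, hi.le.trans (pow_le_pow_right₀ hK1 ?_)⟩
      have : 1 * (j₀ + i + 1) ≤ N * (j₀ + i + 1) :=
        Nat.mul_le_mul_right _ (Nat.one_le_iff_ne_zero.2 hN0)
      omega
    have hlow : K ^ (N * (j₀ + Nat.find hex)) < l e := by
      rcases Nat.eq_zero_or_pos (Nat.find hex) with h0 | h0
      · rw [h0]; exact h'
      · have := not_le.1 (Nat.find_min hex (m := Nat.find hex - 1) (by omega))
        rwa [show j₀ + (Nat.find hex - 1) + 1 = j₀ + Nat.find hex by omega] at this
    have hup := Nat.find_spec hex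
    set i := Nat.find hex
    have hXi : K ^ ((N + 1) * (j₀ + i)) < X e := by
      refine lt_of_le_of_lt ?_ h
      calc K ^ ((N + 1) * (j₀ + i)) = K ^ (((N + 1) * (j₀ + i) : ℕ) : ℝ) :=
            (Real.rpow_natCast _ _).symm
        _ ≤ K ^ (((N * (j₀ + i) : ℕ) : ℝ) * (1 + ε)) := by
            refine Real.rpow_le_rpow_of_exponent_le hK1 ?_
            push_cast
            have : (0 : ℝ) ≤ (j₀ : ℝ) + i := by positivity
            nlinarith
        _ = (K ^ (N * (j₀ + i))) ^ (1 + ε) := by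
            rw [Real.rpow_mul (by linarith), Real.rpow_natCast]
        _ ≤ l e ^ (1 + ε) := by
            refine Real.rpow_le_rpow (by positivity) hlow.le (by linarith)
    refine le_trans ?_ (ENNReal.le_tsum i)
    rw [Set.indicator_of_mem (by exact hXi)]
    have hXpos : 0 ≤ X e := le_trans (by positivity) hXi.le
    rw [max_eq_left hXpos]
    gcongr
    exact hVmono hup
  have hVl : ∀ e, V (l e) ≤ ENNReal.ofReal (2 * C * l e) := fun e =>
    (hVC _ (by linarith [hl1 e])).trans (ENNReal.ofReal_le_ofReal (by nlinarith [hl1 e]))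
  have hVmeas : Measurable fun e => V (l e) := hVmono.measurable.comp hl
  have humeas : Measurable fun e => u (max (X e) 0) := hum.comp (hX.max measurable_const)
  have hfin : ∀ c : ℝ, 0 ≤ c → ∫⁻ e, ENNReal.ofReal (c * l e ^ (2 + ε)) ∂ρ < ⊤ := by
    intro c hc
    simp_rw [ENNReal.ofReal_mul hc]
    rw [lintegral_const_mul' _ _ ENNReal.ofReal_ne_top]
    exact ENNReal.mul_lt_top ENNReal.ofReal_lt_top hmom
  simp_rw [mul_add]
  change ∫⁻ e, (V (l e) * ENNReal.ofReal (l e) + V (l e) * u (max (X e) 0)) ∂ρ < ⊤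
  rw [lintegral_add_left (f := fun e => V (l e) * ENNReal.ofReal (l e))
    (hVmeas.mul hl.ennreal_ofReal)]
  refine ENNReal.add_lt_top.2 ⟨?_, ?_⟩
  · refine lt_of_le_of_lt (lintegral_mono fun e => ?_) (hfin (2 * C) (by positivity))
    have hle := hl1 e
    refine (mul_le_mul' (hVl e) le_rfl).trans ?_
    rw [← ENNReal.ofReal_mul (by positivity)]
    refine ENNReal.ofReal_le_ofReal ?_
    have h1 : l e * l e ≤ l e ^ (2 + ε) := by
      rw [← pow_two, ← Real.rpow_natCast]
      exact Real.rpow_le_rpow_of_exponent_le hle (by push_cast; linarith)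
    rw [mul_assoc]
    gcongr
  · refine lt_of_le_of_lt (lintegral_mono hpt) ?_
    have hm3 : ∀ i : ℕ, MeasurableSet {e | K ^ ((N + 1) * (j₀ + i)) < X e} := fun i =>
      measurableSet_lt measurable_const hX
    rw [lintegral_add_left (f := fun e => V (l e) * u (l e ^ (1 + ε)))
        (hVmeas.mul (hum.comp (hl.pow_const _))),
      lintegral_add_left (f := fun e => V (K ^ (N * j₀)) * u (max (X e) 0))
         (humeas.const_mul _), lintegral_tsum]
    · refine ENNReal.add_lt_top.2 ⟨?_, ENNReal.add_lt_top.2 ⟨?_, ?_⟩⟩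
      · refine lt_of_le_of_lt (lintegral_mono fun e => ?_) (hfin (4 * C * C') (by positivity))
        have hle := hl1 e
        have h1 : 1 ≤ l e ^ (1 + ε) := Real.one_le_rpow hle (by linarith)
        refine (mul_le_mul' (hVl e) (huC _ (by positivity))).trans ?_
        rw [← ENNReal.ofReal_mul (by positivity)]
        refine ENNReal.ofReal_le_ofReal ?_
        have h2 : l e ^ (2 + ε) = l e * l e ^ (1 + ε) := by
          rw [show 2 + ε = 1 + (1 + ε) by ring, Real.rpow_add (by linarith), Real.rpow_one]
        rw [h2]
        calc 2 * C * l e * (C' * (1 + l e ^ (1 + ε)))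
            ≤ 2 * C * l e * (C' * (l e ^ (1 + ε) + l e ^ (1 + ε))) := by gcongr
          _ = _ := by ring
      · rw [lintegral_const_mul _ humeas]
        refine ENNReal.mul_lt_top (lt_of_le_of_lt (hVC _ (by positivity)) ENNReal.ofReal_lt_top)
          (lt_of_le_of_lt (lintegral_renewal_posPart_le ρ hX hA hu) (by simp))
      · have h1 : ∀ i : ℕ, ∫⁻ e, V (K ^ (N * (j₀ + i + 1))) *
            ({e | K ^ ((N + 1) * (j₀ + i)) < X e}).indicator (fun e => u (X e)) e ∂ρ ≤
            2 * 2⁻¹ ^ i := fun i => by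
          rw [lintegral_const_mul (f := ({e | K ^ ((N + 1) * (j₀ + i)) < X e}).indicator
              fun e => u (X e)) _ ((hum.comp hX).indicator (hm3 i)), lintegral_indicator (hm3 i)]
          exact hterm i
        refine lt_of_le_of_lt (ENNReal.tsum_le_tsum h1) ?_
        rw [ENNReal.tsum_mul_left, ENNReal.tsum_geometric]
        refine ENNReal.mul_lt_top (by simp) ?_
        rw [ENNReal.one_sub_inv_two, inv_inv]
        simp
    · exact fun i => (((hum.comp hX).indicator (hm3 i)).const_mul _).aemeasurable

end Moments

section Potential

variable {E : Type*} [MeasurableSpace E] (ρ : Measure E) [IsProbabilityMeasure ρ]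
  {X : E → ℝ} {A : Set ℝ}

lemma tsum_exp_neg_mul_sq_lt_top :
    ∑' j : ℕ, ENNReal.ofReal (Real.exp (-j)) * ((j : ENNReal) + 3) ^ 2 < ⊤ := by
  have h1 : Summable fun j : ℕ => Real.exp 3 * (((j + 3 : ℕ) : ℝ) ^ 2 *
      Real.exp (-1 * ((j + 3 : ℕ) : ℝ))) :=
    ((summable_nat_add_iff 3).2 (Real.summable_pow_mul_exp_neg_nat_mul 2 one_pos)).mul_left _
  have h2 : ∀ j : ℕ, ENNReal.ofReal (Real.exp (-j)) * ((j : ENNReal) + 3) ^ 2 =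
      ENNReal.ofReal (Real.exp 3 * (((j + 3 : ℕ) : ℝ) ^ 2 *
      Real.exp (-1 * ((j + 3 : ℕ) : ℝ)))) := by
    intro j
    have h3 : (j : ENNReal) + 3 = ENNReal.ofReal ((j : ℝ) + 3) := by
      rw [ENNReal.ofReal_add (by positivity) (by norm_num), ENNReal.ofReal_natCast]
      norm_num
    rw [h3, ← ENNReal.ofReal_pow (by positivity), ← ENNReal.ofReal_mul (by positivity)]
    congr 1
    push_cast
    rw [mul_left_comm, ← Real.exp_add, mul_comm]
    congr 2
    ring
  simp_rw [h2]
  exact h1.tsum_ofReal_lt_top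

lemma exists_level_weight (lam D : ℝ) : ∃ j : ℕ, D < lam + j + 1 ∧
    min 1 (ENNReal.ofReal (Real.exp (lam - D))) ≤ ENNReal.ofReal (Real.exp (-j)) := by
  refine ⟨⌊D - lam⌋₊, by linarith [Nat.lt_floor_add_one (D - lam)], ?_⟩
  rcases le_or_gt 0 (D - lam) with h | h
  · refine (min_le_right _ _).trans (ENNReal.ofReal_le_ofReal (Real.exp_le_exp.2 ?_))
    linarith [Nat.floor_le h]
  · rw [Nat.floor_of_nonpos h.le]
    simp

lemma renewal_lt_top (hX : Measurable X) (hA : IsPosHalf A) (hneg : 0 < ρ {e | X e < 0})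
    (a : ℝ) : renewal ρ X A a < ⊤ := by
  obtain ⟨C, -, h⟩ := exists_renewal_le ρ hX hA hneg
  exact (renewal_mono ρ hA (le_max_left a 0)).trans_lt
    ((h _ (le_max_right a 0)).trans_lt ENNReal.ofReal_lt_top)

lemma green_zero_Iio_lt_top (hX : Measurable X) (hA : IsPosHalf A) (hpos : 0 < ρ {e | 0 < X e})
    (t : ℝ) : green ρ X A 0 (Iio t) < ⊤ := by
  obtain ⟨C, -, h⟩ := exists_green_Iio_le ρ hX hA hpos
  exact (green_mono ρ 0 (Iio_subset_Iio (le_max_left t 0))).trans_lt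
    ((h _ (le_max_right t 0)).trans_lt ENNReal.ofReal_lt_top)

/-- The summand of the truncated potential, as a function of the last position `w` and of the
next step `e`. -/
def potentialTerm (X : E → ℝ) (A : Set ℝ) (l : E → ℝ) (w : ℝ) (e : E) : ENNReal :=
  ({e | w + X e ∈ A}).indicator (fun e => min 1 (ENNReal.ofReal
    (Real.exp (l e - min w (w + X e)))) * renewal ρ X A (w + X e)) e

lemma measurable_potentialTerm (hX : Measurable X) (hA : IsPosHalf A) {l : E → ℝ}
    (hl : Measurable l) : Measurable fun p : ℝ × E => potentialTerm ρ X A l p.1 p.2 := by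
  have hw : Measurable fun p : ℝ × E => p.1 + X p.2 :=
    measurable_fst.add (hX.comp measurable_snd)
  have hf : Measurable fun p : ℝ × E => min 1 (ENNReal.ofReal
      (Real.exp (l p.2 - min p.1 (p.1 + X p.2)))) * renewal ρ X A (p.1 + X p.2) :=
    (measurable_const.min (Real.measurable_exp.comp ((hl.comp measurable_snd).sub
      (measurable_fst.min hw))).ennreal_ofReal).mul ((measurable_renewal ρ hA).comp hw)
  exact hf.indicator (hA.measurableSet.preimage hw)

lemma potentialTerm_le (hX : Measurable X) (hA : IsPosHalf A) {l : E → ℝ} {w : ℝ} (hw : 0 ≤ w)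
    (e : E) : potentialTerm ρ X A l w e ≤ ∑' j : ℕ, ENNReal.ofReal (Real.exp (-j)) *
      ((Ico (-X e) (-X e + (l e + j + 1))).indicator
          (fun _ => renewal ρ X A (l e + j + 1)) w +
        (Ico 0 (0 + (l e + j + 1))).indicator
          (fun _ => (1 + green ρ (fun e => -X e) (dualHalf A) 0 (Iio 1)) *
            (renewal ρ X A (l e + j + 1) + renewal ρ X A (max (X e) 0))) w) := by
  by_cases hmem : w + X e ∈ A
  swap
  · rw [potentialTerm, Set.indicator_of_notMem (by exact hmem)]
    exact zero_le
  rw [potentialTerm, Set.indicator_of_mem (by exact hmem)]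
  obtain ⟨j, hj, hle⟩ := exists_level_weight (l e) (min w (w + X e))
  refine le_trans ?_ (ENNReal.le_tsum j)
  refine mul_le_mul' hle ?_
  have hnn := hA.nonneg hmem
  rcases min_lt_iff.1 hj with h | h
  · refine le_trans ?_ le_add_self
    rw [Set.indicator_of_mem (by constructor <;> linarith)]
    calc renewal ρ X A (w + X e) ≤ renewal ρ X A (w + max (X e) 0) :=
          renewal_mono ρ hA (by linarith [le_max_left (X e) 0])
      _ ≤ _ := renewal_add_le ρ hX hA hw (le_max_right _ _)
      _ ≤ _ := by gcongr; exact renewal_mono ρ hA h.le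
  · refine le_trans ?_ le_self_add
    rw [Set.indicator_of_mem (by constructor <;> linarith)]
    exact renewal_mono ρ hA h.le

lemma green_Ico_le (hX : Measurable X) (hA : IsPosHalf A) {y : ℝ} (hy : 0 ≤ y) (c : ℝ)
    {lam : ℝ} (hlam : 1 ≤ lam) (j : ℕ) :
    green ρ X A y (Ico c (c + (lam + j + 1))) ≤ ((j : ENNReal) + 3) * green ρ X A 0 (Iio lam) *
      green ρ (fun e => -X e) (dualHalf A) 0 (Iio (y + 1)) := by
  refine (green_le_mul ρ hX hA hy c _).trans (mul_le_mul' ?_ (green_mono ρ 0 fun z hz => ?_))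
  · calc green ρ X A 0 (Ico 0 (lam + j + 1))
        ≤ green ρ X A 0 (Iio (((j + 3 : ℕ) : ℝ) * lam)) := green_mono ρ 0 fun z hz => by
          refine hz.2.trans_le ?_
          push_cast
          nlinarith [(Nat.cast_nonneg j : (0 : ℝ) ≤ j)]
      _ ≤ ((j + 3 : ℕ) : ENNReal) * green ρ X A 0 (Iio lam) := green_Iio_nat_mul_le ρ hX hA lam _
      _ = _ := by push_cast; rfl
  · have := hz.2
    simp only [mem_Iio]
    linarith

lemma exists_tsum_potentialTerm_le (hX : Measurable X) (hA : IsPosHalf A)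
    (hneg : 0 < ρ {e | X e < 0}) {l : E → ℝ} (hl1 : ∀ e, 1 ≤ l e) {y : ℝ} (hy : 0 ≤ y) :
    ∃ K : ENNReal, K < ⊤ ∧ ∀ e,
      ∑' n, ∫⁻ x in stay X A n y, potentialTerm ρ X A l (y + pathSum X n x) e ∂seqLaw ρ ≤
        K * (green ρ X A 0 (Iio (l e)) *
          (ENNReal.ofReal (l e) + renewal ρ X A (max (X e) 0))) := by
  obtain ⟨C, hC, huC⟩ := exists_renewal_le ρ hX hA hneg
  set C₁ := 1 + green ρ (fun e => -X e) (dualHalf A) 0 (Iio 1) with hC₁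
  set G := green ρ (fun e => -X e) (dualHalf A) 0 (Iio (y + 1)) with hG
  have hneg' : 0 < ρ {e | 0 < -X e} := by simpa using hneg
  have hC₁top : C₁ < ⊤ := ENNReal.add_lt_top.2
    ⟨by simp, green_zero_Iio_lt_top ρ hX.neg hA.dualHalf hneg' 1⟩
  have hGtop : G < ⊤ := green_zero_Iio_lt_top ρ hX.neg hA.dualHalf hneg' _
  set σ := ∑' j : ℕ, ENNReal.ofReal (Real.exp (-j)) * ((j : ENNReal) + 3) ^ 2 with hσ
  have hσtop : σ < ⊤ := tsum_exp_neg_mul_sq_lt_top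
  refine ⟨σ * (G * ((1 + C₁) * (ENNReal.ofReal C + 1))), ?_, fun e => ?_⟩
  · refine ENNReal.mul_lt_top hσtop (ENNReal.mul_lt_top hGtop (ENNReal.mul_lt_top ?_ ?_))
    · exact ENNReal.add_lt_top.2 ⟨by simp, hC₁top⟩
    · exact ENNReal.add_lt_top.2 ⟨ENNReal.ofReal_lt_top, by simp⟩
  have hle := hl1 e
  set r : ℕ → ENNReal := fun j => ENNReal.ofReal (Real.exp (-j)) with hr
  set a : ℕ → ENNReal := fun j => renewal ρ X A (l e + j + 1) with ha
  set b : ℕ → ENNReal := fun j => C₁ * (a j + renewal ρ X A (max (X e) 0)) with hb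
  set Z : ℝ → ℕ → ℕ → Set (ℕ → E) := fun c j n =>
    {x | x ∈ stay X A n y ∧ y + pathSum X n x ∈ Ico c (c + (l e + j + 1))} with hZ
  have hZm : ∀ c j n, MeasurableSet (Z c j n) := fun c j n =>
    (measurableSet_stay hX hA n y).inter
      (measurableSet_Ico.preimage ((measurable_pathSum hX n).const_add y))
  have hn : ∀ n, ∫⁻ x in stay X A n y, potentialTerm ρ X A l (y + pathSum X n x) e ∂seqLaw ρ ≤
      ∑' j, r j * (a j * seqLaw ρ (Z (-X e) j n) + b j * seqLaw ρ (Z 0 j n)) := by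
    intro n
    calc ∫⁻ x in stay X A n y, potentialTerm ρ X A l (y + pathSum X n x) e ∂seqLaw ρ
        ≤ ∫⁻ x, ∑' j, r j * ((Z (-X e) j n).indicator (fun _ => a j) x +
            (Z 0 j n).indicator (fun _ => b j) x) ∂seqLaw ρ := by
          rw [← lintegral_indicator (measurableSet_stay hX hA n y)]
          refine lintegral_mono fun x => ?_
          by_cases hx : x ∈ stay X A n y
          swap
          · rw [Set.indicator_of_notMem hx]; exact zero_le
          rw [Set.indicator_of_mem hx]
          have hw : 0 ≤ y + pathSum X n x := by
            rcases Nat.eq_zero_or_pos n with rfl | h0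
            · simpa using hy
            · exact hA.nonneg (hx n (Finset.mem_Icc.2 ⟨h0, le_rfl⟩))
          refine (potentialTerm_le ρ hX hA hw e).trans (le_of_eq (tsum_congr fun j => ?_))
          congr 2
          · simp only [Set.indicator, hZ, Set.mem_ofPred_eq, hx, true_and, ha]
          · simp only [Set.indicator, hZ, Set.mem_ofPred_eq, hx, true_and, hb, ha, hC₁]
      _ = _ := by
          rw [lintegral_tsum]
          · refine tsum_congr fun j => ?_
            rw [lintegral_const_mul' _ _ ENNReal.ofReal_ne_top,
              lintegral_add_left (measurable_const.indicator (hZm _ _ _)),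
              lintegral_indicator_const (hZm _ _ _), lintegral_indicator_const (hZm _ _ _)]
          · intro j
            exact (((measurable_const.indicator (hZm _ _ _)).add
              (measurable_const.indicator (hZm _ _ _))).const_mul _).aemeasurable
  refine (ENNReal.tsum_le_tsum hn).trans ?_
  rw [ENNReal.tsum_comm]
  set V := green ρ X A 0 (Iio (l e)) with hV
  set U := renewal ρ X A (max (X e) 0) with hU
  have hj : ∀ j, ∑' n, r j * (a j * seqLaw ρ (Z (-X e) j n) + b j * seqLaw ρ (Z 0 j n)) ≤
      (r j * ((j : ENNReal) + 3) ^ 2) *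
        ((G * ((1 + C₁) * (ENNReal.ofReal C + 1))) * (V * (ENNReal.ofReal (l e) + U))) := by
    intro j
    rw [ENNReal.tsum_mul_left, ENNReal.tsum_add, ENNReal.tsum_mul_left, ENNReal.tsum_mul_left,
      mul_assoc (r j)]
    refine mul_le_mul' le_rfl ?_
    have h1 := green_Ico_le ρ hX hA hy (-X e) hle j
    have h2 := green_Ico_le ρ hX hA hy 0 hle j
    have h3 : a j ≤ ((j : ENNReal) + 3) * (ENNReal.ofReal C * ENNReal.ofReal (l e)) := by
      have h4 : (j : ENNReal) + 3 = ENNReal.ofReal ((j : ℝ) + 3) := by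
        rw [ENNReal.ofReal_add (by positivity) (by norm_num), ENNReal.ofReal_natCast]
        norm_num
      have hj0 : (0 : ℝ) ≤ j := Nat.cast_nonneg j
      rw [h4, ← ENNReal.ofReal_mul hC.le, ← ENNReal.ofReal_mul (by positivity)]
      refine (huC _ (by linarith)).trans (ENNReal.ofReal_le_ofReal ?_)
      have : 1 + (l e + j + 1) ≤ (j + 3) * l e := by nlinarith
      nlinarith
    set J := (j : ENNReal) + 3 with hJ
    have hJ1 : 1 ≤ J := le_trans (by norm_num) (le_add_self : (3 : ENNReal) ≤ _)
    set L := ENNReal.ofReal (l e)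
    set c := ENNReal.ofReal C
    calc a j * green ρ X A y (Ico (-X e) (-X e + (l e + j + 1))) +
          b j * green ρ X A y (Ico 0 (0 + (l e + j + 1)))
        ≤ a j * (J * V * G) + b j * (J * V * G) := by gcongr
      _ ≤ (J * (c * L)) * (J * V * G) + C₁ * (J * (c * L) + J * U) * (J * V * G) := by
          simp only [hb]
          gcongr
          exact le_mul_of_one_le_left' hJ1
      _ = J ^ 2 * (G * (V * (c * L + C₁ * (c * L + U)))) := by ring
      _ ≤ J ^ 2 * (G * (V * ((c + 1) * (L + U) + C₁ * ((c + 1) * (L + U))))) := by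
          have h5 : c * L ≤ (c + 1) * (L + U) := mul_le_mul' le_self_add le_self_add
          have h6 : c * L + U ≤ (c + 1) * (L + U) := by
            rw [add_mul, one_mul]
            exact add_le_add (mul_le_mul' le_rfl le_self_add) le_add_self
          gcongr
      _ = _ := by ring
  refine (ENNReal.tsum_le_tsum hj).trans (le_of_eq ?_)
  rw [ENNReal.tsum_mul_right]
  ring

/-- The potential of the truncated terms `e ^ (l - min(Sₙ, Sₙ₊₁))` is finite for the walk
conditioned to stay in `A`. -/
lemma tsum_lintegral_stay_lt_top (hX : Measurable X) (hA : IsPosHalf A)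
    (hpos : 0 < ρ {e | 0 < X e}) (hneg : 0 < ρ {e | X e < 0})
    (hu : RenewalSuperharmonic ρ X A) (hP : PassesLevels ρ X)
    (hP' : PassesLevels ρ fun e => -X e) {l : E → ℝ} (hl : Measurable l)
    (hl1 : ∀ e, 1 ≤ l e) {ε : ℝ} (hε : 0 < ε)
    (hmom : ∫⁻ e, ENNReal.ofReal (l e ^ (2 + ε)) ∂ρ < ⊤) {y : ℝ} (hy : 0 ≤ y) :
    ∑' n, ∫⁻ x in stay X A (n + 1) y, min 1 (ENNReal.ofReal (Real.exp (l (x n) -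
      min (y + pathSum X n x) (y + pathSum X (n + 1) x)))) *
        renewal ρ X A (y + pathSum X (n + 1) x) ∂seqLaw ρ < ⊤ := by
  have hmeas := measurable_potentialTerm ρ hX hA hl
  have hmeas' : Measurable fun p : ℝ × E => potentialTerm ρ X A l (y + p.1) p.2 :=
    hmeas.comp ((measurable_fst.const_add y).prodMk measurable_snd)
  have hn : ∀ n, ∫⁻ x in stay X A (n + 1) y, min 1 (ENNReal.ofReal (Real.exp (l (x n) -
      min (y + pathSum X n x) (y + pathSum X (n + 1) x)))) *
        renewal ρ X A (y + pathSum X (n + 1) x) ∂seqLaw ρ ≤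
      ∫⁻ e, ∫⁻ x in stay X A n y, potentialTerm ρ X A l (y + pathSum X n x) e ∂seqLaw ρ ∂ρ := by
    intro n
    rw [lintegral_lintegral_swap]
    swap
    · exact (hmeas.comp (((measurable_pathSum hX n).const_add y |>.comp measurable_snd).prodMk
        measurable_fst)).aemeasurable
    rw [← setLIntegral_step (h := fun s e => potentialTerm ρ X A l (y + s) e) ρ hX n
      (measurableSet_stay hX hA n y) (fun x z => stay_splice X A le_rfl y x z) hmeas',
      ← lintegral_indicator (measurableSet_stay hX hA n y),
      ← lintegral_indicator (measurableSet_stay hX hA (n + 1) y)]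
    refine lintegral_mono fun x => ?_
    by_cases hx : x ∈ stay X A (n + 1) y
    swap
    · rw [Set.indicator_of_notMem hx]; exact zero_le
    have hx' : x ∈ stay X A n y := fun j hj =>
      hx j (Finset.Icc_subset_Icc_right (Nat.le_succ n) hj)
    have hlast := hx (n + 1) (Finset.mem_Icc.2 ⟨by omega, le_rfl⟩)
    rw [pathSum_succ, ← add_assoc] at hlast
    rw [Set.indicator_of_mem hx, Set.indicator_of_mem hx', potentialTerm,
      Set.indicator_of_mem (by exact hlast), pathSum_succ, ← add_assoc]
  refine (ENNReal.tsum_le_tsum hn).trans_lt ?_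
  rw [← lintegral_tsum]
  swap
  · intro n
    exact (Measurable.lintegral_prod_right' (f := fun p : E × (ℕ → E) =>
      potentialTerm ρ X A l (y + pathSum X n p.2) p.1)
      (hmeas.comp (((measurable_pathSum hX n).const_add y |>.comp measurable_snd).prodMk
        measurable_fst))).aemeasurable
  obtain ⟨K, hK, hKle⟩ := exists_tsum_potentialTerm_le ρ hX hA hneg hl1 hy
  refine (lintegral_mono hKle).trans_lt ?_
  rw [lintegral_const_mul' _ _ hK.ne]
  exact ENNReal.mul_lt_top hK
    (lintegral_green_mul_renewal_lt_top ρ hX hA hpos hneg hu hP hP' hl hl1 hε hmom)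

end Potential

section Transform

variable {E : Type*} [MeasurableSpace E] (ρ : Measure E) [IsProbabilityMeasure ρ]
  {X : E → ℝ} {A : Set ℝ}

variable {ρ} in
lemma PassesLevels.measure_pos (hP : PassesLevels ρ X) :
    0 < ρ {e | 0 < X e} := by
  obtain ⟨p, hp, K, -, z₀, hz₀, h⟩ := hP
  by_contra hcon
  have h0 : ρ {e | 0 < X e} = 0 := nonpos_iff_eq_zero.1 (not_lt.1 hcon)
  have hae : ∀ᵐ x ∂seqLaw ρ, ∀ i, X (x i) ≤ 0 := by
    rw [ae_all_iff]
    intro i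
    have h1 : ∀ᵐ e ∂(seqLaw ρ).map (fun x => x i), X e ≤ 0 := by
      rw [map_eval_seqLaw, ae_iff]
      simpa using h0
    exact ae_of_ae_map (measurable_pi_apply i).aemeasurable h1
  have hnull : seqLaw ρ {x | ∃ n, z₀ ≤ pathSum X n x ∧ ∀ i ≤ n, pathSum X i x ≤ K * z₀} = 0 := by
    refine measure_mono_null ?_ (ae_iff.1 hae)
    rintro x ⟨n, hn, -⟩ hx
    have : pathSum X n x ≤ 0 := Finset.sum_nonpos fun i _ => hx i
    linarith
  exact absurd ((h z₀ le_rfl).trans hnull.le) (not_le.2 hp)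

/-- The measure `P` is the `h`-transform of `μ` by the renewal function, on the event that the walk
started from `a`, with steps `X` evaluated along the environment `q`, stays in `A`. -/
def IsStayTransform {Ω : Type*} [MeasurableSpace Ω] (μ : Measure Ω) (X : E → ℝ) (A : Set ℝ)
    (F : ℕ → MeasurableSpace Ω) (q : Ω → ℕ → E) (a : ℝ) (P : Measure Ω) : Prop :=
  IsProbabilityMeasure P ∧ ∀ (n : ℕ) (g : Ω → ℝ), Measurable[F n] g → (∃ C, ∀ ω, |g ω| ≤ C) →
    ∫ ω, g ω ∂P = (renewal ρ X A a).toReal⁻¹ *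
      ∫ ω in q ⁻¹' stay X A n a, g ω * (renewal ρ X A (a + pathSum X n (q ω))).toReal ∂μ

lemma one_le_toReal_renewal (hX : Measurable X) (hA : IsPosHalf A)
    (hneg : 0 < ρ {e | X e < 0}) (a : ℝ) : 1 ≤ (renewal ρ X A a).toReal := by
  rw [← ENNReal.toReal_one]
  exact ENNReal.toReal_mono (renewal_lt_top ρ hX hA hneg a).ne (one_le_renewal ρ a)

variable {Ω : Type*} [MeasurableSpace Ω] {μ : Measure Ω} {F : ℕ → MeasurableSpace Ω}
  {q : Ω → ℕ → E}

lemma renewalSuperharmonic_of_transform (hX : Measurable X) (hA : IsPosHalf A)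
    (hneg : 0 < ρ {e | X e < 0}) (hq : Measurable q) (hμ : μ.map q = seqLaw ρ)
    (hP : ∀ a, 0 ≤ a → ∃ P, IsStayTransform ρ μ X A F q a P) : RenewalSuperharmonic ρ X A := by
  intro a ha
  obtain ⟨P, hPp, h⟩ := hP a ha
  have h1 := h 1 (fun _ => 1) (@measurable_const _ _ _ (F 1) _) ⟨1, fun _ => by simp⟩
  have hU := one_le_toReal_renewal ρ hX hA hneg a
  set I := ∫ ω in q ⁻¹' stay X A 1 a,
    (1 : ℝ) * (renewal ρ X A (a + pathSum X 1 (q ω))).toReal ∂μ with hI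
  have hIU : I = (renewal ρ X A a).toReal := by
    simp only [integral_const, probReal_univ, smul_eq_mul, mul_one] at h1
    field_simp at h1
    exact h1.symm
  have hint : Integrable (fun ω => (1 : ℝ) * (renewal ρ X A (a + pathSum X 1 (q ω))).toReal)
      (μ.restrict (q ⁻¹' stay X A 1 a)) := by
    by_contra hcon
    rw [hI, integral_undef hcon] at hIU
    linarith
  have h2 := ofReal_integral_eq_lintegral_ofReal hint (ae_of_all _ fun ω => by positivity)
  rw [← hI, hIU, ENNReal.ofReal_toReal (renewal_lt_top ρ hX hA hneg a).ne] at h2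
  rw [h2]
  have hm : Measurable fun x : ℕ → E => renewal ρ X A (a + pathSum X 1 x) :=
    (measurable_renewal ρ hA).comp ((measurable_pathSum hX 1).const_add a)
  refine le_of_eq ?_
  calc ∫⁻ e in {e | a + X e ∈ A}, renewal ρ X A (a + X e) ∂ρ
      = ∫⁻ x in stay X A 1 a, renewal ρ X A (a + pathSum X 1 x) ∂seqLaw ρ := by
        have hstay : (fun x : ℕ → E => x 0) ⁻¹' {e | a + X e ∈ A} = stay X A 1 a := by
          ext x
          simp [stay, pathSum_one]
        have hset := setLIntegral_map (μ := seqLaw ρ) (g := fun x => x 0)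
          (f := fun e => renewal ρ X A (a + X e))
          (hA.measurableSet.preimage (hX.const_add a))
          ((measurable_renewal ρ hA).comp (hX.const_add a)) (measurable_pi_apply 0)
        rw [map_eval_seqLaw] at hset
        simp_rw [pathSum_one, ← hstay]
        exact hset
    _ = ∫⁻ ω in q ⁻¹' stay X A 1 a, renewal ρ X A (a + pathSum X 1 (q ω)) ∂μ := by
        rw [← hμ, setLIntegral_map (measurableSet_stay hX hA 1 a) hm hq]
    _ = _ := by
        refine lintegral_congr fun ω => ?_
        rw [one_mul, ENNReal.ofReal_toReal (renewal_lt_top ρ hX hA hneg _).ne]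

lemma lintegral_le_of_transform (hX : Measurable X) (hA : IsPosHalf A)
    (hneg : 0 < ρ {e | X e < 0}) (hq : Measurable q) (hμ : μ.map q = seqLaw ρ)
    (hF : ∀ n, F n ≤ ‹MeasurableSpace Ω›) {a : ℝ} {P : Measure Ω}
    (hP : IsStayTransform ρ μ X A F q a P) {n : ℕ} {g : Ω → ℝ} (hg : Measurable[F n] g)
    (hg0 : ∀ ω, 0 ≤ g ω) (hg1 : ∀ ω, g ω ≤ 1) {G : (ℕ → E) → ENNReal} (hG : Measurable G)
    (hgG : ∀ ω, ENNReal.ofReal (g ω) ≤ G (q ω)) :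
    ∫⁻ ω, ENNReal.ofReal (g ω) ∂P ≤
      ∫⁻ x in stay X A n a, G x * renewal ρ X A (a + pathSum X n x) ∂seqLaw ρ := by
  obtain ⟨hPp, h⟩ := hP
  have hbd : ∀ ω, |g ω| ≤ 1 := fun ω => by rw [abs_of_nonneg (hg0 ω)]; exact hg1 ω
  have hint : Integrable g P := Integrable.of_bound
    (hg.mono (hF n) le_rfl).aestronglyMeasurable 1 (ae_of_all _ hbd)
  rw [← ofReal_integral_eq_lintegral_ofReal hint (ae_of_all _ hg0), h n g hg ⟨1, hbd⟩]
  have hU := one_le_toReal_renewal ρ hX hA hneg a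
  have hI0 : 0 ≤ ∫ ω in q ⁻¹' stay X A n a,
      g ω * (renewal ρ X A (a + pathSum X n (q ω))).toReal ∂μ :=
    integral_nonneg fun ω => mul_nonneg (hg0 ω) ENNReal.toReal_nonneg
  refine (ENNReal.ofReal_le_ofReal (mul_le_of_le_one_left hI0 (inv_le_one_of_one_le₀ hU))).trans ?_
  rw [← Real.enorm_of_nonneg hI0]
  refine (enorm_integral_le_lintegral_enorm _).trans ?_
  have hm : Measurable fun x : ℕ → E => G x * renewal ρ X A (a + pathSum X n x) :=
    hG.mul ((measurable_renewal ρ hA).comp ((measurable_pathSum hX n).const_add a))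
  rw [← hμ, setLIntegral_map (measurableSet_stay hX hA n a) hm hq]
  refine lintegral_mono fun ω => ?_
  rw [Real.enorm_of_nonneg (mul_nonneg (hg0 ω) ENNReal.toReal_nonneg),
    ENNReal.ofReal_mul (hg0 ω), ENNReal.ofReal_toReal (renewal_lt_top ρ hX hA hneg _).ne]
  exact mul_le_mul' (hgG ω) le_rfl

lemma ofReal_min_one_le {t C r : ℝ} (h : t ≤ C * Real.exp r) :
    ENNReal.ofReal (min 1 t) ≤
      ENNReal.ofReal (max 1 C) * min 1 (ENNReal.ofReal (Real.exp r)) := by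
  have h1 : min 1 (ENNReal.ofReal (Real.exp r)) = ENNReal.ofReal (min 1 (Real.exp r)) := by
    rw [ENNReal.ofReal_min, ENNReal.ofReal_one]
  rw [h1, ← ENNReal.ofReal_mul (by positivity)]
  refine ENNReal.ofReal_le_ofReal ?_
  rcases le_total 1 (Real.exp r) with h2 | h2
  · rw [min_eq_left h2, mul_one]
    exact (min_le_left _ _).trans (le_max_left _ _)
  · rw [min_eq_right h2]
    refine (min_le_right _ _).trans (h.trans ?_)
    gcongr
    exact le_max_right _ _

/-- Nonnegative terms bounded by `C e ^ (l - min(Sₙ, Sₙ₊₁))` are almost surely summable under the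
transformed measure. -/
lemma ae_summable_of_transform (hX : Measurable X) (hA : IsPosHalf A)
    (hpos : 0 < ρ {e | 0 < X e}) (hneg : 0 < ρ {e | X e < 0})
    (hu : RenewalSuperharmonic ρ X A) (hPL : PassesLevels ρ X)
    (hPL' : PassesLevels ρ fun e => -X e) {l : E → ℝ} (hl : Measurable l)
    (hl1 : ∀ e, 1 ≤ l e) {ε : ℝ} (hε : 0 < ε)
    (hmom : ∫⁻ e, ENNReal.ofReal (l e ^ (2 + ε)) ∂ρ < ⊤)
    (hq : Measurable q) (hμ : μ.map q = seqLaw ρ)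
    (hF : ∀ n, F n ≤ ‹MeasurableSpace Ω›) {a : ℝ} (ha : 0 ≤ a) {P : Measure Ω}
    (hP : IsStayTransform ρ μ X A F q a P) {t : ℕ → Ω → ℝ}
    (ht : ∀ n, Measurable[F (n + 1)] (t n)) (ht0 : ∀ n ω, 0 ≤ t n ω) {C : ℝ}
    (htC : ∀ n ω, t n ω ≤ C * Real.exp (l (q ω n) -
      min (a + pathSum X n (q ω)) (a + pathSum X (n + 1) (q ω)))) :
    ∀ᵐ ω ∂P, Summable fun n => t n ω := by
  have hmin : ∀ n, Measurable[F (n + 1)] fun ω => min 1 (t n ω) := fun n =>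
    Measurable.min (@measurable_const _ _ _ (F (n + 1)) _) (ht n)
  have hsum : ∫⁻ ω, ∑' n, ENNReal.ofReal (min 1 (t n ω)) ∂P < ⊤ := by
    rw [lintegral_tsum fun n => ((hmin n).mono (hF _) le_rfl).ennreal_ofReal.aemeasurable]
    have hle : ∀ n, ∫⁻ ω, ENNReal.ofReal (min 1 (t n ω)) ∂P ≤
        ENNReal.ofReal (max 1 C) * ∫⁻ x in stay X A (n + 1) a, min 1 (ENNReal.ofReal
          (Real.exp (l (x n) - min (a + pathSum X n x) (a + pathSum X (n + 1) x)))) *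
            renewal ρ X A (a + pathSum X (n + 1) x) ∂seqLaw ρ := by
      intro n
      rw [← lintegral_const_mul' _ _ ENNReal.ofReal_ne_top]
      simp_rw [← mul_assoc]
      refine lintegral_le_of_transform ρ hX hA hneg hq hμ hF hP (hmin n)
        (fun ω => le_min zero_le_one (ht0 n ω)) (fun ω => min_le_left _ _)
        (G := fun x => ENNReal.ofReal (max 1 C) * min 1 (ENNReal.ofReal (Real.exp (l (x n) -
          min (a + pathSum X n x) (a + pathSum X (n + 1) x))))) ?_
        fun ω => ofReal_min_one_le (htC n ω)
      have h1 := (measurable_pathSum hX n).const_add a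
      have h2 := (measurable_pathSum hX (n + 1)).const_add a
      have h3 : Measurable fun x : ℕ → E => l (x n) := hl.comp (measurable_pi_apply n)
      exact (measurable_const.min
        (Real.measurable_exp.comp (h3.sub (h1.min h2))).ennreal_ofReal).const_mul _
    refine (ENNReal.tsum_le_tsum hle).trans_lt ?_
    rw [ENNReal.tsum_mul_left]
    exact ENNReal.mul_lt_top ENNReal.ofReal_lt_top
      (tsum_lintegral_stay_lt_top ρ hX hA hpos hneg hu hPL hPL' hl hl1 hε hmom ha)
  have hae := ae_lt_top (Measurable.tsum fun n =>
    ((hmin n).mono (hF _) le_rfl).ennreal_ofReal) hsum.ne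
  filter_upwards [hae] with ω hω
  have hs : Summable fun n => min 1 (t n ω) := by
    refine (ENNReal.summable_toReal hω.ne).congr fun n => ?_
    exact ENNReal.toReal_ofReal (le_min zero_le_one (ht0 n ω))
  have hev : ∀ᶠ n in atTop, min 1 (t n ω) = t n ω := by
    filter_upwards [hs.tendsto_atTop_zero.eventually_lt_const one_pos] with n hn
    rcases min_lt_iff.1 hn with h | h
    · exact absurd h (lt_irrefl _)
    · exact min_eq_right h.le
  exact (summable_congr_atTop hev).1 hs

end Transform

section Walk

variable {Θ : Type*}

lemma walk_eq_pathSum {E : Type*} (Q : ℕ → Θ → E) (X : E → ℝ) (n : ℕ) (ω : Θ) :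
    walk (fun n ω => X (Q n ω)) n ω = pathSum X n fun i => Q (i + 1) ω := by
  induction n with
  | zero => simp [walk]
  | succ n ih =>
    rw [pathSum_succ, ← ih, walk, walk, Finset.sum_Icc_succ_top (by omega)]

lemma Mwalk_succ_lt_iff (X : ℕ → Θ → ℝ) (k : ℕ) (ω : Θ) :
    Mwalk X (k + 1) ω < 0 ↔ ∀ i ∈ Finset.Icc 1 (k + 1), walk X i ω < 0 := by
  rw [Mwalk, Finset.sup'_lt_iff]

lemma le_Lwalk_succ_iff (X : ℕ → Θ → ℝ) (k : ℕ) (ω : Θ) :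
    0 ≤ Lwalk X (k + 1) ω ↔ ∀ i ∈ Finset.Icc 1 (k + 1), 0 ≤ walk X i ω := by
  rw [Lwalk, Finset.le_inf'_iff]

lemma measurable_envFiltration {E : Type*} [MeasurableSpace E] {Q : ℕ → Θ → E}
    {i n : ℕ} (hi : i ∈ Finset.Icc 1 n) :
    Measurable[envFiltration Q n] (Q i) :=
  (comap_measurable (Q i)).mono
    (le_iSup₂_of_le (f := fun i (_ : i ∈ Finset.Icc 1 n) =>
      MeasurableSpace.comap (Q i) inferInstance) i hi le_rfl) le_rfl

lemma measurable_walk_envFiltration {E : Type*} [MeasurableSpace E] {Q : ℕ → Θ → E}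
    {X : E → ℝ} (hX : Measurable X) {k n : ℕ} (hk : k ≤ n) :
    Measurable[envFiltration Q n] (walk (fun n ω => X (Q n ω)) k) := by
  refine @Finset.measurable_fun_sum _ _ _ _ _ _ (envFiltration Q n) _ _ fun i hi => ?_
  exact hX.comp (measurable_envFiltration (Finset.Icc_subset_Icc_right hk hi))

end Walk

section Environment

variable {Ω : Type*} [MeasurableSpace Ω] {E : Type*} [MeasurableSpace E]

lemma IIDseq.map_eq_seqLaw {μ : Measure Ω} {Q : ℕ → Ω → E} (hiid : IIDseq μ Q)
    {ρ : Measure E} [IsProbabilityMeasure ρ] (hρ : μ.map (Q 1) = ρ) :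
    μ.map (fun ω i => Q (i + 1) ω) = seqLaw ρ := by
  obtain ⟨hmeas, hind, hid⟩ := hiid
  have hind' : iIndepFun (fun i => Q (i + 1)) μ :=
    hind.precomp (g := fun i : ℕ => i + 1) (add_left_injective 1)
  rw [hind'.map_fun_eq_infinitePi_map₀' fun i => (hmeas _).aemeasurable, seqLaw]
  congr 1
  ext1 i
  rw [(hid (i + 1)).map_eq, hρ]

lemma toReal_renewal (ρ : Measure E) [IsProbabilityMeasure ρ] {X : E → ℝ} {A : Set ℝ}
    (hX : Measurable X) (hA : IsPosHalf A) (hneg : 0 < ρ {e | X e < 0}) (a : ℝ) :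
    (renewal ρ X A a).toReal = 1 + ∑' k : ℕ, (seqLaw ρ {x | a + pathSum X (k + 1) x ∈ A ∧
      ∀ i ∈ Finset.Icc 1 (k + 1), pathSum X i x ∉ A}).toReal := by
  have h := (renewal_lt_top ρ hX hA hneg a).ne
  rw [renewal] at h ⊢
  rw [ENNReal.toReal_add (by simp) (ne_top_of_le_ne_top h le_add_self), ENNReal.toReal_one,
    ENNReal.tsum_toReal_eq fun k => measure_ne_top _ _]

lemma measurableSet_renewal_event {X : E → ℝ} {A : Set ℝ} (hX : Measurable X) (hA : IsPosHalf A)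
    (a : ℝ) (k : ℕ) : MeasurableSet {x | a + pathSum X (k + 1) x ∈ A ∧
      ∀ i ∈ Finset.Icc 1 (k + 1), pathSum X i x ∉ A} := by
  refine (hA.measurableSet.preimage ((measurable_pathSum hX _).const_add a)).inter ?_
  have : {x : ℕ → E | ∀ i ∈ Finset.Icc 1 (k + 1), pathSum X i x ∉ A} =
      ⋂ i ∈ Finset.Icc 1 (k + 1), {x | pathSum X i x ∉ A} := by
    ext x; simp
  change MeasurableSet {x : ℕ → E | ∀ i ∈ Finset.Icc 1 (k + 1), pathSum X i x ∉ A}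
  rw [this]
  exact Finset.measurableSet_biInter _ fun i _ =>
    (hA.measurableSet.preimage (measurable_pathSum hX i)).compl

variable {μ : Measure Ω} {Q : ℕ → Ω → E} {X : E → ℝ} {ρ : Measure E} [IsProbabilityMeasure ρ]

lemma uFun_eq_renewal (hX : Measurable X) (hneg : 0 < ρ {e | X e < 0})
    (hq : Measurable fun ω i => Q (i + 1) ω) (hμ : μ.map (fun ω i => Q (i + 1) ω) = seqLaw ρ)
    {x : ℝ} (hx : 0 ≤ x) :
    uFun μ (fun n ω => X (Q n ω)) x = (renewal ρ X (Ici 0) x).toReal := by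
  rw [toReal_renewal ρ hX (Or.inl rfl) hneg, uFun, if_pos hx]
  congr 1
  refine tsum_congr fun k => ?_
  rw [← hμ, Measure.map_apply hq (measurableSet_renewal_event hX (Or.inl rfl) x k)]
  congr 2
  ext ω
  simp only [Set.mem_ofPred_eq, Mwalk_succ_lt_iff, walk_eq_pathSum, mem_preimage, mem_Ici, not_le,
    neg_le_iff_add_nonneg]

lemma vFun_eq_renewal (hX : Measurable X) (hpos : 0 < ρ {e | 0 < X e})
    (hq : Measurable fun ω i => Q (i + 1) ω) (hμ : μ.map (fun ω i => Q (i + 1) ω) = seqLaw ρ)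
    {x : ℝ} (hx : x ≤ 0) :
    vFun μ (fun n ω => X (Q n ω)) x =
      (renewal ρ (fun e => -X e) (Ioi 0) (-x)).toReal := by
  rw [toReal_renewal ρ (X := fun e => -X e) hX.neg (Or.inr rfl) (by simpa using hpos), vFun,
    if_pos hx]
  congr 1
  refine tsum_congr fun k => ?_
  rw [← hμ, Measure.map_apply hq
    (measurableSet_renewal_event (X := fun e => -X e) hX.neg (Or.inr rfl) (-x) k)]
  congr 2
  ext ω
  simp only [Set.mem_ofPred_eq, le_Lwalk_succ_iff, walk_eq_pathSum, mem_preimage, mem_Ioi, not_lt,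
    pathSum_neg, neg_nonpos]
  refine and_congr_left fun _ => ?_
  constructor <;> intro h <;> linarith

lemma IsPplus.isStayTransform (hX : Measurable X) (hneg : 0 < ρ {e | X e < 0})
    (hQ : ∀ n, Measurable (Q n)) (hμ : μ.map (fun ω i => Q (i + 1) ω) = seqLaw ρ)
    {F : ℕ → MeasurableSpace Ω} {x : ℝ} (hx : 0 ≤ x) {P : Measure Ω}
    (h : IsPplus μ (fun n ω => X (Q n ω)) F x P) :
    IsStayTransform ρ μ X (Ici 0) F (fun ω i => Q (i + 1) ω) x P := by
  have hq : Measurable fun ω i => Q (i + 1) ω := measurable_pi_iff.2 fun i => hQ (i + 1)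
  refine ⟨h.1, fun n g hg hb => ?_⟩
  rw [h.2 n g hg hb, uFun_eq_renewal hX hneg hq hμ hx]
  have hset : posSet (fun n ω => X (Q n ω)) x n =
      (fun ω i => Q (i + 1) ω) ⁻¹' stay X (Ici 0) n x := by
    ext ω
    simp [posSet, stay, walk_eq_pathSum]
  rw [hset]
  congr 1
  refine setIntegral_congr_fun ((measurableSet_stay hX (Or.inl rfl) n x).preimage hq) ?_
  intro ω hω
  have hnn : 0 ≤ x + pathSum X n fun i => Q (i + 1) ω := by
    rcases Nat.eq_zero_or_pos n with rfl | h0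
    · simpa using hx
    · exact hω n (Finset.mem_Icc.2 ⟨h0, le_rfl⟩)
  simp only [walk_eq_pathSum]
  rw [uFun_eq_renewal hX hneg hq hμ hnn]

lemma IsPminus.isStayTransform (hX : Measurable X) (hpos : 0 < ρ {e | 0 < X e})
    (hQ : ∀ n, Measurable (Q n)) (hμ : μ.map (fun ω i => Q (i + 1) ω) = seqLaw ρ)
    {F : ℕ → MeasurableSpace Ω} {x : ℝ} (hx : x ≤ 0) {P : Measure Ω}
    (h : IsPminus μ (fun n ω => X (Q n ω)) F x P) :
    IsStayTransform ρ μ (fun e => -X e) (Ioi 0) F (fun ω i => Q (i + 1) ω) (-x) P := by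
  have hq : Measurable fun ω i => Q (i + 1) ω := measurable_pi_iff.2 fun i => hQ (i + 1)
  refine ⟨h.1, fun n g hg hb => ?_⟩
  rw [h.2 n g hg hb, vFun_eq_renewal hX hpos hq hμ hx]
  have hset : negSet (fun n ω => X (Q n ω)) x n =
      (fun ω i => Q (i + 1) ω) ⁻¹' stay (fun e => -X e) (Ioi 0) n (-x) := by
    ext ω
    simp only [negSet, stay, walk_eq_pathSum, Set.mem_ofPred_eq, mem_preimage, mem_Ioi,
      pathSum_neg]
    refine forall₂_congr fun i _ => ?_
    constructor <;> intro h <;> linarith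
  rw [hset]
  congr 1
  refine setIntegral_congr_fun ((measurableSet_stay hX.neg (Or.inr rfl) n (-x)).preimage hq) ?_
  intro ω hω
  have hnp : x + pathSum X n (fun i => Q (i + 1) ω) ≤ 0 := by
    rcases Nat.eq_zero_or_pos n with rfl | h0
    · simpa using hx
    · have h1 := hω n (Finset.mem_Icc.2 ⟨h0, le_rfl⟩)
      simp only [pathSum_neg, mem_Ioi] at h1
      linarith
  simp only [walk_eq_pathSum]
  rw [vFun_eq_renewal hX hpos hq hμ hnp, pathSum_neg, neg_add]

lemma AssumptionA4.passesLevels (hX : Measurable X) (hQ : ∀ n, Measurable (Q n))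
    (hμ : μ.map (fun ω i => Q (i + 1) ω) = seqLaw ρ) {c : ℕ → ℝ}
    (h : AssumptionA4 μ (fun n ω => X (Q n ω)) c) :
    PassesLevels ρ X ∧ PassesLevels ρ fun e => -X e := by
  obtain ⟨hc, -, α, ν, hν, -, hνneg, hνpos, hw⟩ := h
  have hq : Measurable fun ω i => Q (i + 1) ω := measurable_pi_iff.2 fun i => hQ (i + 1)
  have hmeas : ∀ n, Measurable fun x => pathSum X n x / c n := fun n =>
    (measurable_pathSum hX n).div_const _
  have hlaw : ∀ n, (μ.map fun ω => walk (fun n ω => X (Q n ω)) n ω / c n) =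
      (seqLaw ρ).map fun x => pathSum X n x / c n := by
    intro n
    rw [← hμ, Measure.map_map (hmeas n) hq]
    congr 1
    ext ω
    simp [walk_eq_pathSum]
  simp_rw [hlaw] at hw
  refine ⟨passesLevels_of_weakTendsto ρ hX hc hνpos hw, ?_⟩
  have : IsProbabilityMeasure (ν.map fun r => -r) :=
    Measure.isProbabilityMeasure_map measurable_neg.aemeasurable
  refine passesLevels_of_weakTendsto ρ hX.neg hc (ν := ν.map fun r => -r) ?_ fun g => ?_
  · rw [Measure.map_apply measurable_neg measurableSet_Ioi]
    convert hνneg using 2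
    ext r
    simp
  · have hlim := hw (g.compContinuous ⟨fun r => -r, continuous_neg⟩)
    have hneg : ∀ n, ((seqLaw ρ).map fun x => pathSum (fun e => -X e) n x / c n) =
        ((seqLaw ρ).map fun x => pathSum X n x / c n).map fun r => -r := by
      intro n
      rw [Measure.map_map measurable_neg (hmeas n)]
      congr 1
      ext x
      simp [pathSum_neg, neg_div]
    simp_rw [hneg]
    have hg : ∀ κ : Measure ℝ, ∫ r, g r ∂(κ.map fun r => -r) =
        ∫ r, g.compContinuous ⟨fun r => -r, continuous_neg⟩ r ∂κ := fun κ =>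
      integral_map measurable_neg.aemeasurable g.continuous.aestronglyMeasurable
    simp_rw [hg]
    exact hlim

lemma envFiltration_le (hQ : ∀ n, Measurable (Q n)) (n : ℕ) :
    envFiltration Q n ≤ ‹MeasurableSpace Ω› :=
  iSup₂_le fun i _ => (hQ i).comap_le

end Environment

section Offspring

/-- Mean of the offspring law `e`. -/
def offMean (e : Measure ℕ) : ℝ := ∑' i : ℕ, (i : ℝ) * (e {i}).toReal

/-- Step of the associated random walk for the offspring law `e`. -/
def offStep (e : Measure ℕ) : ℝ := Real.log (offMean e)

/-- Normalized second factorial moment of the offspring law `e`. -/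
def offEta (e : Measure ℕ) : ℝ :=
  (∑' i : ℕ, ((i : ℝ) * ((i : ℝ) - 1)) * (e {i}).toReal) / (2 * offMean e ^ 2)

/-- Normalized truncated second moment of the offspring law `e`. -/
def offZeta (a : ℕ) (e : Measure ℕ) : ℝ :=
  (∑' y : ℕ, if a ≤ y then (y : ℝ) ^ 2 * (e {y}).toReal else 0) / offMean e ^ 2

/-- The logarithmic size of `1 + offZeta a e`. -/
def offLevel (a : ℕ) (e : Measure ℕ) : ℝ := 1 + Real.log (max (offZeta a e) 1)

lemma measurable_weight (i : ℕ) : Measurable fun e : Measure ℕ => (e {i}).toReal :=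
  (Measure.measurable_coe (measurableSet_singleton i)).ennreal_toReal

lemma measurable_offMean : Measurable offMean :=
  Measurable.tsum fun i => (measurable_weight i).const_mul _

lemma measurable_offStep : Measurable offStep := Real.measurable_log.comp measurable_offMean

lemma measurable_offEta : Measurable offEta :=
  (Measurable.tsum fun i => (measurable_weight i).const_mul _).div
    ((measurable_offMean.pow_const 2).const_mul 2)

lemma measurable_offZeta (a : ℕ) : Measurable (offZeta a) := by
  refine Measurable.div (Measurable.tsum fun i => ?_) (measurable_offMean.pow_const 2)
  by_cases h : a ≤ i
  · simpa only [h, if_true] using (measurable_weight i).const_mul _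
  · simp only [h, if_false, measurable_const]

lemma measurable_offLevel (a : ℕ) : Measurable (offLevel a) :=
  (Real.measurable_log.comp ((measurable_offZeta a).max measurable_const)).const_add 1

lemma one_le_offLevel (a : ℕ) (e : Measure ℕ) : 1 ≤ offLevel a e :=
  le_add_of_nonneg_right (Real.log_nonneg (le_max_right _ _))

lemma factorial_moment_nonneg (e : Measure ℕ) (i : ℕ) :
    0 ≤ ((i : ℝ) * ((i : ℝ) - 1)) * (e {i}).toReal := by
  refine mul_nonneg ?_ ENNReal.toReal_nonneg
  rcases Nat.eq_zero_or_pos i with rfl | h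
  · simp
  · have : (1 : ℝ) ≤ i := by exact_mod_cast h
    nlinarith

lemma offEta_nonneg (e : Measure ℕ) : 0 ≤ offEta e :=
  div_nonneg (tsum_nonneg (factorial_moment_nonneg e)) (by positivity)

lemma offZeta_nonneg (a : ℕ) (e : Measure ℕ) : 0 ≤ offZeta a e :=
  div_nonneg (tsum_nonneg fun y => by split_ifs <;> positivity) (by positivity)

lemma offEta_le {a : ℕ} (e : Measure ℕ) :
    offEta e ≤ a * Real.exp (-offStep e) + offZeta a e := by
  have hζ := offZeta_nonneg a e
  have hm0 : 0 ≤ offMean e := tsum_nonneg fun i => by positivity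
  have hrhs : 0 ≤ a * Real.exp (-offStep e) + offZeta a e := by positivity
  rcases hm0.eq_or_lt with hm | hm
  · simpa [offEta, ← hm] using hrhs
  have hs1 : Summable fun i : ℕ => (i : ℝ) * (e {i}).toReal := by
    by_contra h
    rw [offMean, tsum_eq_zero_of_not_summable h] at hm
    exact lt_irrefl _ hm
  by_cases hs2 : Summable fun i : ℕ => ((i : ℝ) * ((i : ℝ) - 1)) * (e {i}).toReal
  swap
  · simpa [offEta, tsum_eq_zero_of_not_summable hs2] using hrhs
  have hs3 : Summable fun y : ℕ => if a ≤ y then (y : ℝ) ^ 2 * (e {y}).toReal else 0 := by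
    refine Summable.of_nonneg_of_le (fun y => by split_ifs <;> positivity) (fun y => ?_)
      (hs2.add hs1)
    have h1 := factorial_moment_nonneg e y
    have h2 : 0 ≤ (y : ℝ) * (e {y}).toReal := by positivity
    split_ifs
    · exact le_of_eq (by ring)
    · linarith
  have hle : ∑' i : ℕ, ((i : ℝ) * ((i : ℝ) - 1)) * (e {i}).toReal ≤
      a * offMean e + ∑' y : ℕ, if a ≤ y then (y : ℝ) ^ 2 * (e {y}).toReal else 0 := by
    rw [offMean, ← tsum_mul_left, ← (hs1.mul_left _).tsum_add hs3]
    refine hs2.tsum_le_tsum (fun i => ?_) ((hs1.mul_left _).add hs3)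
    have hw : 0 ≤ (e {i}).toReal := ENNReal.toReal_nonneg
    have hi : (0 : ℝ) ≤ i := Nat.cast_nonneg i
    split_ifs with h
    · have : 0 ≤ (a : ℝ) * (i * (e {i}).toReal) := by positivity
      nlinarith [mul_nonneg hi hw]
    · have : (i : ℝ) ≤ a := by exact_mod_cast (not_le.1 h).le
      rw [add_zero, ← mul_assoc]
      refine mul_le_mul_of_nonneg_right ?_ hw
      nlinarith
  calc offEta e ≤ (a * offMean e +
        ∑' y : ℕ, if a ≤ y then (y : ℝ) ^ 2 * (e {y}).toReal else 0) / (2 * offMean e ^ 2) := by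
        unfold offEta; gcongr
    _ = (a * (offMean e)⁻¹ + offZeta a e) / 2 := by
        unfold offZeta; field_simp
    _ ≤ a * (offMean e)⁻¹ + offZeta a e := half_le_self (by positivity)
    _ = _ := by rw [offStep, Real.exp_neg, Real.exp_log hm]

lemma offEta_le_exp {a : ℕ} (ha : 1 ≤ a) (e : Measure ℕ) :
    offEta e ≤ a * Real.exp (offLevel a e - min 0 (offStep e)) := by
  have hζ := offZeta_nonneg a e
  have ha' : (1 : ℝ) ≤ a := by exact_mod_cast ha
  have h1 : 1 + offZeta a e ≤ Real.exp (offLevel a e) := by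
    rw [offLevel, Real.exp_add, Real.exp_log (by positivity)]
    have h2 : (2 : ℝ) ≤ Real.exp 1 := by linarith [Real.add_one_le_exp (1 : ℝ)]
    have h3 := le_max_left (offZeta a e) 1
    have h4 := le_max_right (offZeta a e) 1
    nlinarith
  have h2 : Real.exp (-offStep e) ≤ Real.exp (-min 0 (offStep e)) :=
    Real.exp_le_exp.2 (neg_le_neg (min_le_right _ _))
  have h3 : 1 ≤ Real.exp (-min 0 (offStep e)) :=
    Real.one_le_exp (neg_nonneg.2 (min_le_left _ _))
  set M := Real.exp (-min 0 (offStep e))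
  calc offEta e ≤ a * Real.exp (-offStep e) + offZeta a e := offEta_le e
    _ ≤ a * M + a * (offZeta a e * M) := by
        gcongr
        nlinarith [mul_le_mul ha' h3 zero_le_one (by linarith)]
    _ = a * ((1 + offZeta a e) * M) := by ring
    _ ≤ a * (Real.exp (offLevel a e) * M) := by gcongr
    _ = _ := by rw [← Real.exp_add, ← sub_eq_add_neg]

lemma lintegral_offLevel_rpow_lt_top {Ω : Type*} [MeasurableSpace Ω] {μ : Measure Ω}
    [IsFiniteMeasure μ] {Q : Ω → Measure ℕ} (hQ : Measurable Q) {a : ℕ} {ε : ℝ} (hε : 0 < ε)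
    (h : Integrable (fun ω => Real.log (max (offZeta a (Q ω)) 1) ^ (2 + ε)) μ) :
    ∫⁻ e, ENNReal.ofReal (offLevel a e ^ (2 + ε)) ∂μ.map Q < ⊤ := by
  rw [lintegral_map ((measurable_offLevel a).pow_const _).ennreal_ofReal hQ]
  refine lt_of_le_of_lt (lintegral_mono fun ω => ENNReal.ofReal_le_ofReal ?_)
    (((integrable_const (1 : ℝ)).add h).const_mul (2 ^ (2 + ε))).lintegral_lt_top
  simp only [Pi.add_apply]
  set r := Real.log (max (offZeta a (Q ω)) 1) with hr
  have hr0 : 0 ≤ r := Real.log_nonneg (le_max_right _ _)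
  have hp : 0 ≤ 2 + ε := by linarith
  change (1 + r) ^ (2 + ε) ≤ _
  have hrp := Real.rpow_nonneg hr0 (2 + ε)
  rcases le_total r 1 with h1 | h1
  · calc (1 + r) ^ (2 + ε) ≤ 2 ^ (2 + ε) := Real.rpow_le_rpow (by linarith) (by linarith) hp
      _ ≤ _ := le_mul_of_one_le_right (by positivity) (by linarith)
  · calc (1 + r) ^ (2 + ε) ≤ (2 * r) ^ (2 + ε) :=
          Real.rpow_le_rpow (by linarith) (by linarith) hp
      _ = 2 ^ (2 + ε) * r ^ (2 + ε) := Real.mul_rpow (by norm_num) hr0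
      _ ≤ _ := by gcongr; linarith

end Offspring

/-- **Lemma `Lold1` (ABKV, Lemma 3.1).** Under A3 and A4, for any `x ≥ 0` the series
`B⁺ = ∑_{i=0}^∞ η_{i+1} e^{-S_i}` converges (i.e. `b_n → B⁺ < ∞`) `P_x⁺`-a.s., and for
any `x ≤ 0` the series `B⁻ = ∑_{i=1}^∞ η_i e^{S_i}` converges `P_x⁻`-a.s. -/
theorem statement7
    {Ω : Type*} [MeasurableSpace Ω] (μ : Measure Ω) [IsProbabilityMeasure μ]
    (Q : ℕ → Ω → Measure ℕ) (hQprob : ∀ n ω, IsProbabilityMeasure (Q n ω))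
    (hiid : IIDseq μ Q) (c : ℕ → ℝ)
    (hA3 : AssumptionA3 μ Q) (hA4 : AssumptionA4 μ (Xenv Q) c)
    (Pp Pm : ℝ → Measure Ω)
    (hPp : ∀ x : ℝ, 0 ≤ x → IsPplus μ (Xenv Q) (envFiltration Q) x (Pp x))
    (hPm : ∀ x : ℝ, x ≤ 0 → IsPminus μ (Xenv Q) (envFiltration Q) x (Pm x)) :
    (∀ x : ℝ, 0 ≤ x → ∀ᵐ ω ∂(Pp x),
      ∃ B : ℝ, Tendsto (fun n : ℕ => bEnv Q n ω) atTop (𝓝 B)) ∧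
    (∀ x : ℝ, x ≤ 0 → ∀ᵐ ω ∂(Pm x),
      ∃ B : ℝ, Tendsto
        (fun n : ℕ => ∑ i ∈ Finset.Icc 1 n, etaEnv Q i ω * Real.exp (Senv Q i ω))
        atTop (𝓝 B)) := by
  obtain ⟨ε, hε, a, ha, hA3⟩ := hA3
  have hQ := hiid.1
  set ρ : Measure (Measure ℕ) := μ.map (Q 1) with hρ
  have : IsProbabilityMeasure ρ := Measure.isProbabilityMeasure_map (hQ 1).aemeasurable
  have hX := measurable_offStep
  have hq : Measurable fun ω i => Q (i + 1) ω := measurable_pi_iff.2 fun i => hQ (i + 1)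
  have hμ : μ.map (fun ω i => Q (i + 1) ω) = seqLaw ρ := hiid.map_eq_seqLaw hρ.symm
  obtain ⟨hPL, hPL'⟩ := AssumptionA4.passesLevels hX hQ hμ hA4
  have hpos := hPL.measure_pos
  have hneg : 0 < ρ {e | offStep e < 0} := by simpa using hPL'.measure_pos
  have hmom : ∫⁻ e, ENNReal.ofReal (offLevel a e ^ (2 + ε)) ∂ρ < ⊤ :=
    lintegral_offLevel_rpow_lt_top (hQ 1) hε hA3
  have hSmeas : ∀ {k n}, k ≤ n → Measurable[envFiltration Q n] (Senv Q k) := fun hk =>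
    measurable_walk_envFiltration hX hk
  have hηmeas : ∀ n, Measurable[envFiltration Q (n + 1)] (etaEnv Q (n + 1)) := fun n =>
    measurable_offEta.comp (measurable_envFiltration (Finset.mem_Icc.2 ⟨by omega, le_rfl⟩))
  have hη0 : ∀ n ω, 0 ≤ etaEnv Q n ω := fun n ω => offEta_nonneg (Q n ω)
  have hSpath : ∀ n ω, Senv Q n ω = pathSum offStep n fun i => Q (i + 1) ω := fun n ω =>
    walk_eq_pathSum Q offStep n ω
  refine ⟨fun x hx => ?_, fun x hx => ?_⟩
  · have hT : ∀ y, 0 ≤ y → IsStayTransform ρ μ offStep (Ici 0) (envFiltration Q)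
        (fun ω i => Q (i + 1) ω) y (Pp y) := fun y hy =>
      IsPplus.isStayTransform hX hneg hQ hμ hy (hPp y hy)
    have hsum := ae_summable_of_transform ρ hX (Or.inl rfl) hpos hneg
      (renewalSuperharmonic_of_transform ρ hX (Or.inl rfl) hneg hq hμ fun y hy => ⟨_, hT y hy⟩)
      hPL hPL' (measurable_offLevel a) (one_le_offLevel a) hε hmom hq hμ (envFiltration_le hQ)
      hx (hT x hx) (t := fun n ω => etaEnv Q (n + 1) ω * Real.exp (-(Senv Q n ω)))
      (C := a * Real.exp x)
      (fun n => Measurable.mul (hηmeas n)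
        (Real.measurable_exp.comp (Measurable.neg (hSmeas (Nat.le_succ n)))))
      (fun n ω => mul_nonneg (hη0 _ _) (Real.exp_pos _).le)
      (fun n ω => ?_)
    · filter_upwards [hsum] with ω hω
      exact ⟨_, hω.hasSum.tendsto_sum_nat⟩
    · rw [hSpath, pathSum_succ]
      set s := pathSum offStep n fun i => Q (i + 1) ω
      set r := offStep (Q (n + 1) ω) with hr
      have hmin : min (x + s) (x + (s + r)) = x + s + min 0 r := by
        rw [← min_add_add_left, add_zero, add_assoc]
      calc etaEnv Q (n + 1) ω * Real.exp (-s)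
          ≤ a * Real.exp (offLevel a (Q (n + 1) ω) - min 0 r) * Real.exp (-s) := by
            gcongr
            exact offEta_le_exp ha _
        _ = _ := by
            rw [hmin, mul_assoc, mul_assoc, ← Real.exp_add, ← Real.exp_add]
            congr 2
            ring
  · have hT : ∀ y, 0 ≤ y → IsStayTransform ρ μ (fun e => -offStep e) (Ioi 0) (envFiltration Q)
        (fun ω i => Q (i + 1) ω) y (Pm (-y)) := fun y hy => by
      simpa using IsPminus.isStayTransform hX hpos hQ hμ (neg_nonpos.2 hy)
        (hPm (-y) (neg_nonpos.2 hy))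
    have hsum := ae_summable_of_transform ρ (X := fun e => -offStep e) hX.neg (Or.inr rfl)
      (by simpa using hneg) (by simpa using hpos)
      (renewalSuperharmonic_of_transform ρ hX.neg (Or.inr rfl) (by simpa using hpos) hq hμ
        fun y hy => ⟨_, hT y hy⟩)
      hPL' (by simpa using hPL) (measurable_offLevel a) (one_le_offLevel a) hε hmom hq hμ
      (envFiltration_le hQ) (neg_nonneg.2 hx) (hT (-x) (neg_nonneg.2 hx))
      (t := fun n ω => etaEnv Q (n + 1) ω * Real.exp (Senv Q (n + 1) ω))
      (C := a * Real.exp (-x))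
      (fun n => Measurable.mul (hηmeas n) (Real.measurable_exp.comp (hSmeas le_rfl)))
      (fun n ω => mul_nonneg (hη0 _ _) (Real.exp_pos _).le)
      (fun n ω => ?_)
    · rw [neg_neg] at hsum
      filter_upwards [hsum] with ω hω
      refine ⟨_, hω.hasSum.tendsto_sum_nat.congr fun n => ?_⟩
      rw [Finset.range_eq_Ico, Finset.sum_Ico_add' (fun i => etaEnv Q i ω * Real.exp (Senv Q i ω))]
      rfl
    · simp only [hSpath, pathSum_neg, pathSum_succ]
      set s := pathSum offStep n fun i => Q (i + 1) ω
      set r := offStep (Q (n + 1) ω) with hr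
      have hmin : min (-x + -s) (-x + (-s + -r)) = -x - s - r + min 0 r := by
        rcases le_total r 0 with h | h
        · rw [min_eq_right h, min_eq_left (by linarith)]; ring
        · rw [min_eq_left h, min_eq_right (by linarith)]; ring
      calc etaEnv Q (n + 1) ω * Real.exp (s + r)
          ≤ a * Real.exp (offLevel a (Q (n + 1) ω) - min 0 r) * Real.exp (s + r) := by
            gcongr
            exact offEta_le_exp ha _
        _ = _ := by
            rw [hmin, mul_assoc, mul_assoc, ← Real.exp_add, ← Real.exp_add]
            congr 2
            ring

end BPREpaper
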